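/- Let p > 1, T > 0 and a, b > 0. A function u ∈ W^{1,p}_0(-T,T) with u not identically zero satisfies ∫_{-T}^T a^p((u')^+)^p + b^p((u')^-)^p dt = λ_p^{a,b}(-T,T) ∫_{-T}^T |u|^p dt if and only if, for some constant c > 0 and with t_0 := ((a-b)/(a+b))T, either u(t) = c·φ_p(T(t-t_0)/(T+t_0)) for t ∈ (-T,t_0) and u(t) = c·φ_p(T(t-t_0)/(T-t_0)) for t ∈ [t_0,T), or u(t) = -c·φ_p(T(t+t_0)/(T-t_0)) for t ∈ (-T,-t_0) and u(t) = -c·φ_p(T(t+t_0)/(T+t_0)) for t ∈ [-t_0,T). -/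

import Mathlib

open MeasureTheory Filter Set
open scoped Topology RealInnerProductSpace

noncomputable section

/-- Positive part. -/
def ppart (t : ℝ) : ℝ := max t 0
/-- Negative part. -/
def npart (t : ℝ) : ℝ := max (-t) 0

/-- `u ∈ W^{1,p}(α,β)` (continuous representative on `[α,β]`), with weak derivative `u'`. -/
def MemW1pC (p α β : ℝ) (u u' : ℝ → ℝ) : Prop :=
  IntervalIntegrable u' volume α β ∧
  (∀ t ∈ Set.Icc α β, u t = u α + ∫ s in α..t, u' s) ∧
  IntegrableOn (fun t => |u' t| ^ p) (Set.Ioo α β) volume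

/-- `u ∈ W^{1,p}_0(α,β)`, with weak derivative `u'`. -/
def MemW1p0 (p α β : ℝ) (u u' : ℝ → ℝ) : Prop :=
  MemW1pC p α β u u' ∧ u α = 0 ∧ u β = 0

/-- `u ∈ W^{1,p}(α,β)` (interior version: no constraint at endpoints). -/
def MemW1pI (p α β : ℝ) (u u' : ℝ → ℝ) : Prop :=
  IntervalIntegrable u' volume α β ∧
  (∀ s ∈ Set.Ioo α β, ∀ t ∈ Set.Ioo α β, u t = u s + ∫ r in s..t, u' r) ∧
  IntegrableOn (fun t => |u' t| ^ p) (Set.Ioo α β) volume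

/-- `λ_p^H(α,β)` for a one-dimensional anisotropy `H`. -/
def lamH1 (p : ℝ) (H : ℝ → ℝ) (α β : ℝ) : ℝ :=
  sInf { E | ∃ u u', MemW1p0 p α β u u' ∧ (∫ t in Set.Ioo α β, |u t| ^ p) = 1 ∧
    E = ∫ t in Set.Ioo α β, H (u' t) ^ p }

/-- `λ_{1,p}(α,β)`, the principal Dirichlet eigenvalue of the 1d `p`-Laplacian. -/
def lam1 (p α β : ℝ) : ℝ := lamH1 p (fun t => |t|) α β

/-- `λ_p^{a,b}(α,β)`. -/
def lamAB (p a b α β : ℝ) : ℝ := lamH1 p (fun t => a * ppart t + b * npart t) α β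

/-- `λ_p^+(-T,T)`. -/
def lamPlus (p T : ℝ) : ℝ := lamH1 p ppart (-T) T

/-- `φ` is the (normalized positive) principal eigenfunction of the 1d `p`-Laplacian
on `(-T,T)`, with weak derivative `φ'`. -/
def IsPrincipalEigenfunction (p T : ℝ) (φ φ' : ℝ → ℝ) : Prop :=
  MemW1p0 p (-T) T φ φ' ∧ (∀ t ∈ Set.Ioo (-T) T, 0 < φ t) ∧
  (∫ t in Set.Ioo (-T) T, |φ t| ^ p) = 1 ∧
  (∫ t in Set.Ioo (-T) T, |φ' t| ^ p) = lam1 p (-T) T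

/-- The piecewise Sobolev class `W_pw^{1,p,+}(-T,T)`. -/
def MemWpw (p T : ℝ) (u u' : ℝ → ℝ) : Prop :=
  ∃ (m : ℕ) (P : ℕ → ℝ), 0 < m ∧ P 0 = -T ∧ P m = T ∧
    (∀ i < m, P i < P (i + 1)) ∧
    (∀ i < m, MemW1pI p (P i) (P (i + 1)) u u') ∧
    (∃ l₀, Tendsto u (𝓝[>] (-T)) (𝓝 l₀) ∧ l₀ ≤ 0) ∧
    (∃ l₁, Tendsto u (𝓝[<] T) (𝓝 l₁) ∧ 0 ≤ l₁) ∧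
    (∀ i, 0 < i → i < m → ∃ lm lp, Tendsto u (𝓝[<] (P i)) (𝓝 lm) ∧
      Tendsto u (𝓝[>] (P i)) (𝓝 lp) ∧ lp < lm)

/-! ### Two dimensions -/

/-- The Euclidean plane. -/
abbrev V2 := EuclideanSpace ℝ (Fin 2)

/-- The point of `ℝ²` with coordinates `(x, y)`. -/
def mk2 (x y : ℝ) : V2 := (EuclideanSpace.equiv (Fin 2) ℝ).symm ![x, y]

/-- An asymmetric anisotropy: nonnegative, convex and positively 1-homogeneous. -/
def IsAnisotropy (H : V2 → ℝ) : Prop :=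
  (∀ v, 0 ≤ H v) ∧ ConvexOn ℝ Set.univ H ∧ ∀ t : ℝ, 0 < t → ∀ v : V2, H (t • v) = t * H v

/-- A bounded domain of `ℝ²`. -/
def IsBoundedDomain (Ω : Set V2) : Prop :=
  IsOpen Ω ∧ IsConnected Ω ∧ Bornology.IsBounded Ω

/-- Smooth compactly supported test function on `Ω`. -/
def TestFun2 (Ω : Set V2) (φ : V2 → ℝ) : Prop :=
  ContDiff ℝ (⊤ : ℕ∞) φ ∧ HasCompactSupport φ ∧ tsupport φ ⊆ Ω

/-- `u ∈ W^{1,p}_0(Ω)`, with weak gradient `g`: `u` and `g` are `p`-integrable on `Ω`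
and approximable in `W^{1,p}`-norm by smooth functions compactly supported in `Ω`. -/
def MemW1p02 (p : ℝ) (Ω : Set V2) (u : V2 → ℝ) (g : V2 → V2) : Prop :=
  IntegrableOn (fun x => |u x| ^ p) Ω volume ∧
  IntegrableOn (fun x => ‖g x‖ ^ p) Ω volume ∧
  ∃ φ : ℕ → V2 → ℝ, (∀ n, TestFun2 Ω (φ n)) ∧
    Tendsto (fun n => ∫ x in Ω, |u x - φ n x| ^ p) atTop (𝓝 0) ∧
    Tendsto (fun n => ∫ x in Ω, ‖g x - gradient (φ n) x‖ ^ p) atTop (𝓝 0)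

/-- The least anisotropic energy level `λ_p^H(Ω)`. -/
def lamH (p : ℝ) (H : V2 → ℝ) (Ω : Set V2) : ℝ :=
  sInf { E | ∃ u g, MemW1p02 p Ω u g ∧ (∫ x in Ω, |u x| ^ p) = 1 ∧
    E = ∫ x in Ω, H (g x) ^ p }

/-- `λ_p^H(Ω)` is a fundamental frequency of `-Δ_p^H` on `Ω`. -/
def IsFundFreq (p : ℝ) (H : V2 → ℝ) (Ω : Set V2) : Prop :=
  ∃ u g, MemW1p02 p Ω u g ∧ ¬ (∀ᵐ x ∂(volume.restrict Ω), u x = 0) ∧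
    (∀ᵐ x ∂(volume.restrict Ω), DifferentiableAt ℝ H (g x)) ∧
    AEMeasurable (fun x => gradient H (g x)) (volume.restrict Ω) ∧
    ∀ φ gφ, MemW1p02 p Ω φ gφ →
      (∫ x in Ω, H (g x) ^ (p - 1) * ⟪gradient H (g x), gφ x⟫) =
        lamH p H Ω * ∫ x in Ω, |u x| ^ (p - 2) * u x * φ x

/-- The infimum `λ_p^H(Ω)` is attained by a (normalized, hence nonzero) function. -/
def IsAttained (p : ℝ) (H : V2 → ℝ) (Ω : Set V2) : Prop :=
  ∃ u g, MemW1p02 p Ω u g ∧ (∫ x in Ω, |u x| ^ p) = 1 ∧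
    (∫ x in Ω, H (g x) ^ p) = lamH p H Ω

/-- `‖H‖ := max {H v : |v| = 1}`. -/
def normH (H : V2 → ℝ) : ℝ := sSup (H '' Metric.sphere 0 1)

/-- A rotation: a linear isometry with positive determinant. -/
def IsRotation (A : V2 ≃ₗᵢ[ℝ] V2) : Prop :=
  0 < LinearMap.det (A.toLinearEquiv : V2 →ₗ[ℝ] V2)

/-- The kernel of an anisotropy. -/
def kerH (H : V2 → ℝ) : Set V2 := {v | H v = 0}

/-- `S` is a line through the origin. -/
def IsLine (S : Set V2) : Prop := ∃ v : V2, v ≠ 0 ∧ S = {w | ∃ t : ℝ, w = t • v}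

/-- `S` is a closed half-plane bounded by a line through the origin. -/
def IsClosedHalfPlane (S : Set V2) : Prop := ∃ v : V2, v ≠ 0 ∧ S = {w | ⟪v, w⟫ ≤ 0}

/-- Smooth compactly supported test function on an open set `S ⊆ ℝ`. -/
def TestFun1 (S : Set ℝ) (φ : ℝ → ℝ) : Prop :=
  ContDiff ℝ (⊤ : ℕ∞) φ ∧ HasCompactSupport φ ∧ tsupport φ ⊆ S

/-- `v ∈ W^{1,p}_0(S)` for an open set `S ⊆ ℝ`, with weak derivative `v'`. -/
def MemW1p0S (p : ℝ) (S : Set ℝ) (v v' : ℝ → ℝ) : Prop :=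
  IntegrableOn (fun t => |v t| ^ p) S volume ∧
  IntegrableOn (fun t => |v' t| ^ p) S volume ∧
  ∃ φ : ℕ → ℝ → ℝ, (∀ n, TestFun1 S (φ n)) ∧
    Tendsto (fun n => ∫ t in S, |v t - φ n t| ^ p) atTop (𝓝 0) ∧
    Tendsto (fun n => ∫ t in S, |v' t - deriv (φ n) t| ^ p) atTop (𝓝 0)

/-- A bounded domain with Lipschitz (`C^{0,1}`) boundary: near each boundary point, after a
rigid motion, `Ω` is the region above the graph of a Lipschitz function. -/
def IsC01Domain (Ω : Set V2) : Prop :=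
  IsBoundedDomain Ω ∧
  ∀ z ∈ frontier Ω, ∃ (A : V2 ≃ₗᵢ[ℝ] V2) (r K : ℝ) (f : ℝ → ℝ), 0 < r ∧ 0 ≤ K ∧
    LipschitzWith (Real.toNNReal K) f ∧
    ∀ v ∈ Metric.ball z r, (v ∈ Ω ↔ f ((A (v - z)) 0) < (A (v - z)) 1)

/-- The supremal length of a vertical open segment contained in `D`. -/
def vertWidth (D : Set V2) : ℝ :=
  sSup {l : ℝ | ∃ x c : ℝ, ∀ y ∈ Set.Ioo c (c + l), mk2 x y ∈ D}

/-- The width function `L_θ` of `Ω` in direction `θ`. -/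
def widthFn (Ω : Set V2) (θ : ℝ) : ℝ :=
  sSup {l : ℝ | ∃ (v : V2) (t0 : ℝ),
    ∀ t ∈ Set.Ioo t0 (t0 + l), v + t • mk2 (Real.cos θ) (Real.sin θ) ∈ Ω}

/-- The variational `p`-capacity of `K` relative to `B`. -/
def pCap (p : ℝ) (K B : Set V2) : ℝ :=
  sInf { E | ∃ φ : V2 → ℝ, ContDiff ℝ (⊤ : ℕ∞) φ ∧ HasCompactSupport φ ∧ tsupport φ ⊆ B ∧
    (∀ x ∈ K, 1 ≤ φ x) ∧ E = ∫ x, ‖gradient φ x‖ ^ p }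

/-- The Wiener criterion for the `p`-Laplacian at a boundary point `z`:
the Wiener integral diverges. -/
def WienerRegularAt (p : ℝ) (Ω : Set V2) (z : V2) : Prop :=
  ¬ IntegrableOn (fun t =>
      (pCap p (Metric.closedBall z t \ Ω) (Metric.ball z (2 * t)) /
        pCap p (Metric.closedBall z t) (Metric.ball z (2 * t))) ^ (1 / (p - 1)) / t)
    (Set.Ioo (0 : ℝ) 1) volume

/-- The optimal lower spectral constant `Λ^min(Ω)`. -/
def LambdaMin (p : ℝ) (Ω : Set V2) : ℝ :=
  sInf {lam : ℝ | ∃ H : V2 → ℝ, IsAnisotropy H ∧ normH H = 1 ∧ IsFundFreq p H Ω ∧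
    lam = lamH p H Ω}

end

noncomputable section

lemma rpow_tangent_lt {p v y : ℝ} (hp : 1 < p) (hy : 0 < y) (hv : v ≠ y) :
    p * y ^ (p - 1) * v - (p - 1) * y ^ p < (max v 0) ^ p := by
  have hyp : y ^ p = y ^ (p - 1) * y := by
    rw [← Real.rpow_add_one hy.ne']; ring_nf
  have hy1 : 0 < y ^ (p - 1) := Real.rpow_pos_of_pos hy _
  rcases le_or_gt 0 v with h | h
  · rw [max_eq_left h]
    have hb := one_add_mul_self_lt_rpow_one_add (s := v / y - 1)
      (by have := div_nonneg h hy.le; linarith)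
      (by rw [sub_ne_zero]; intro h'; exact hv ((div_eq_one_iff_eq hy.ne').1 h')) hp
    rw [add_sub_cancel, Real.div_rpow h hy.le, lt_div_iff₀ (Real.rpow_pos_of_pos hy _)] at hb
    refine lt_of_eq_of_lt ?_ hb
    rw [hyp]; field_simp; ring
  · rw [max_eq_right h.le, Real.zero_rpow (by linarith), hyp]
    have h1 : 0 < p * y ^ (p - 1) := by positivity
    have h2 : 0 < (p - 1) * (y ^ (p - 1) * y) := mul_pos (by linarith) (by positivity)
    nlinarith

lemma rpow_tangent_eq {p y : ℝ} (hy : 0 < y) :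
    p * y ^ (p - 1) * y - (p - 1) * y ^ p = (max y 0) ^ p := by
  have hyp : y ^ p = y ^ (p - 1) * y := by
    rw [← Real.rpow_add_one hy.ne']; ring_nf
  rw [max_eq_left hy.le, hyp]; ring

lemma rpow_tangent_le {p v y : ℝ} (hp : 1 < p) (hy : 0 ≤ y) :
    p * y ^ (p - 1) * v - (p - 1) * y ^ p ≤ (max v 0) ^ p := by
  rcases hy.eq_or_lt with rfl | hy
  · rw [Real.zero_rpow (by linarith), Real.zero_rpow (by linarith)]
    simp only [mul_zero, zero_mul, sub_zero]
    positivity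
  · by_cases hv : v = y
    · rw [hv, rpow_tangent_eq hy]
    · exact (rpow_tangent_lt hp hy hv).le

lemma hasDerivAt_max_zero_rpow {p : ℝ} (hp : 1 < p) (x : ℝ) :
    HasDerivAt (fun x : ℝ => (max x 0) ^ p) (p * (max x 0) ^ (p - 1)) x := by
  have h1 : ∀ x : ℝ, HasDerivAt (fun x : ℝ => x ^ p) (p * x ^ (p - 1)) x := fun x =>
    Real.hasDerivAt_rpow_const (Or.inr hp.le)
  rcases lt_trichotomy x 0 with h | rfl | h
  · rw [max_eq_right h.le, Real.zero_rpow (by linarith), mul_zero]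
    refine (hasDerivAt_const x (0 : ℝ)).congr_of_eventuallyEq ?_
    filter_upwards [Iio_mem_nhds h] with y hy
    rw [max_eq_right (le_of_lt hy), Real.zero_rpow (by linarith)]
  · have hz : p * (max (0 : ℝ) 0) ^ (p - 1) = 0 := by
      rw [max_self, Real.zero_rpow (by linarith), mul_zero]
    rw [hz]
    have hr : HasDerivWithinAt (fun x : ℝ => (max x 0) ^ p) 0 (Ici 0) 0 := by
      have := (h1 0).hasDerivWithinAt (s := Ici 0)
      rw [Real.zero_rpow (by linarith), mul_zero] at this
      exact this.congr (fun y hy => by rw [max_eq_left hy]) (by simp)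
    have hl : HasDerivWithinAt (fun x : ℝ => (max x 0) ^ p) 0 (Iic 0) 0 :=
      (hasDerivWithinAt_const 0 _ (0 : ℝ)).congr
        (fun y hy => by rw [max_eq_right hy, Real.zero_rpow (by linarith)])
        (by simp [Real.zero_rpow (show p ≠ 0 by linarith)])
    have := hl.union hr
    rwa [Iic_union_Ici, hasDerivWithinAt_univ] at this
  · rw [max_eq_left h.le]
    refine (h1 x).congr_of_eventuallyEq ?_
    filter_upwards [Ioi_mem_nhds h] with y hy
    rw [max_eq_left (le_of_lt hy)]

open AbsolutelyContinuousOnInterval in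
lemma AbsolutelyContinuousOnInterval.congr_on {f g : ℝ → ℝ} {a b : ℝ}
    (hf : AbsolutelyContinuousOnInterval f a b) (h : ∀ t ∈ uIcc a b, g t = f t) :
    AbsolutelyContinuousOnInterval g a b := by
  rw [absolutelyContinuousOnInterval_iff] at hf ⊢
  intro ε hε
  obtain ⟨δ, hδ, H⟩ := hf ε hε
  refine ⟨δ, hδ, fun E hE hs => lt_of_eq_of_lt (Finset.sum_congr rfl fun i hi => ?_) (H E hE hs)⟩
  rw [h _ (hE.1 i hi).1, h _ (hE.1 i hi).2]

open AbsolutelyContinuousOnInterval in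
lemma AbsolutelyContinuousOnInterval.lipschitz_comp {f g : ℝ → ℝ} {a b : ℝ} {K : NNReal}
    {s : Set ℝ} (hf : AbsolutelyContinuousOnInterval f a b) (hg : LipschitzOnWith K g s)
    (hs : ∀ t ∈ uIcc a b, f t ∈ s) :
    AbsolutelyContinuousOnInterval (fun t => g (f t)) a b := by
  rw [absolutelyContinuousOnInterval_iff] at hf ⊢
  intro ε hε
  obtain ⟨δ, hδ, H⟩ := hf (ε / (K + 1)) (by positivity)
  refine ⟨δ, hδ, fun E hE hs' => ?_⟩
  calc _ ≤ ∑ i ∈ Finset.range E.1, K * dist (f (E.2 i).1) (f (E.2 i).2) :=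
        Finset.sum_le_sum fun i hi =>
          hg.dist_le_mul _ (hs _ (hE.1 i hi).1) _ (hs _ (hE.1 i hi).2)
    _ = K * ∑ i ∈ Finset.range E.1, dist (f (E.2 i).1) (f (E.2 i).2) := by
        rw [Finset.mul_sum]
    _ ≤ K * (ε / (K + 1)) := by gcongr; exact (H E hE hs').le
    _ < (K + 1) * (ε / (K + 1)) := by gcongr; linarith
    _ = ε := by field

lemma AbsolutelyContinuousOnInterval.max_zero_rpow {f : ℝ → ℝ} {a b p : ℝ} (hp : 1 < p)
    (hf : AbsolutelyContinuousOnInterval f a b) :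
    AbsolutelyContinuousOnInterval (fun t => (max (f t) 0) ^ p) a b := by
  obtain ⟨B, hB⟩ := hf.exists_bound
  have hlip : LipschitzOnWith (Real.toNNReal (p * (max B 0) ^ (p - 1)))
      (fun x : ℝ => (max x 0) ^ p) (Iic B) := by
    refine (convex_Iic B).lipschitzOnWith_of_nnnorm_hasDerivWithin_le
      (fun x _ => (hasDerivAt_max_zero_rpow hp x).hasDerivWithinAt) fun x hx => ?_
    rw [← NNReal.coe_le_coe, coe_nnnorm, Real.coe_toNNReal _ (by positivity), Real.norm_eq_abs,
      abs_of_nonneg (by positivity)]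
    have hx' : x ≤ B := hx
    have h1 : 0 ≤ p - 1 := by linarith
    gcongr
  exact hf.lipschitz_comp (g := fun x : ℝ => (max x 0) ^ p) hlip fun t ht =>
    (Real.le_norm_self _).trans (hB t ht)

lemma absolutelyContinuousOnInterval_of_hasDerivAt {f f' : ℝ → ℝ} {a b : ℝ} (hab : a ≤ b)
    (hf : ∀ t ∈ Icc a b, HasDerivAt f (f' t) t) (hc : ContinuousOn f' (Icc a b)) :
    AbsolutelyContinuousOnInterval f a b := by
  obtain ⟨C, hC⟩ := isCompact_Icc.exists_bound_of_continuousOn hc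
  have : LipschitzOnWith (Real.toNNReal C) f (Icc a b) := by
    refine (convex_Icc a b).lipschitzOnWith_of_nnnorm_hasDerivWithin_le
      (fun x hx => (hf x hx).hasDerivWithinAt) fun x hx => ?_
    rw [← NNReal.coe_le_coe, coe_nnnorm, Real.coe_toNNReal']
    exact (hC x hx).trans (le_max_left _ _)
  rw [← uIcc_of_le hab] at this
  exact this.absolutelyContinuousOnInterval

/-- `s` is the generalized sine on its quarter period `[0, M]`, normalized by `s M = 1`, and
`g = (s' / s) ^ (p - 1)` is the solution of the associated Riccati equation. -/
structure IsSineProfile (p M : ℝ) (g s : ℝ → ℝ) : Prop where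
  quarter_pos : 0 < M
  g_end : g M = 0
  g_pos : ∀ t ∈ Ioo 0 M, 0 < g t
  g_le : ∀ t ∈ Ioo 0 M, g t ≤ t ^ (-(p - 1))
  g_deriv : ∀ t ∈ Ioc 0 M, HasDerivAt g (-(1 + (p - 1) * g t ^ (p / (p - 1)))) t
  s_zero : s 0 = 0
  s_end : s M = 1
  s_pos : ∀ t ∈ Ioc 0 M, 0 < s t
  s_cont : ContinuousOn s (Icc 0 M)
  s_deriv : ∀ t ∈ Ioc 0 M, HasDerivAt s (s t * g t ^ (1 / (p - 1))) t
  s_deriv_bdd : ∀ t ∈ Ioc 0 M, (s t * g t ^ (1 / (p - 1))) ^ p ≤ 1 / (p - 1)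

/-- A strictly increasing solution of `S' = 1 / (1 + (p - 1) x₊ ^ (p / (p - 1)))`
with limit `M` at `∞`. -/
lemma exists_riccati_time {p : ℝ} (hp : 1 < p) :
    ∃ (M : ℝ) (S : ℝ → ℝ), StrictMono S ∧ S 0 = 0 ∧ (∀ x, S x < M) ∧
      (∀ y < M, ∃ x, S x = y) ∧ (∀ x > 0, M ≤ S x + x ^ (-(1 / (p - 1)))) ∧
      ∀ x, HasDerivAt S (1 + (p - 1) * (max x 0) ^ (p / (p - 1)))⁻¹ x := by
  have hp1 : 0 < p - 1 := by linarith
  have hr : 0 < p / (p - 1) := by positivity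
  set D : ℝ → ℝ := fun x => 1 + (p - 1) * (max x 0) ^ (p / (p - 1)) with hD
  have hDpos : ∀ x, 0 < D x := fun x => by
    have : 0 ≤ (max x 0) ^ (p / (p - 1)) := Real.rpow_nonneg (le_max_right _ _) _
    simp only [hD]; positivity
  have hDc : Continuous D := by
    refine continuous_const.add (continuous_const.mul ?_)
    exact (continuous_id.max continuous_const).rpow_const fun x => Or.inr hr.le
  have hDic : Continuous fun x => (D x)⁻¹ := hDc.inv₀ fun x => (hDpos x).ne'
  set S : ℝ → ℝ := fun x => ∫ y in (0 : ℝ)..x, (D y)⁻¹ with hS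
  have hder : ∀ x, HasDerivAt S (D x)⁻¹ x := fun x =>
    intervalIntegral.integral_hasDerivAt_right (hDic.intervalIntegrable _ _)
      (hDic.stronglyMeasurableAtFilter _ _) hDic.continuousAt
  have hmono : StrictMono S :=
    strictMono_of_hasDerivAt_pos hder fun x => inv_pos.2 (hDpos x)
  have hS0 : S 0 = 0 := by simp [hS]
  have hSc : Continuous S := continuous_iff_continuousAt.2 fun x => (hder x).continuousAt
  have hneg : ∀ x ≤ 0, S x = x := by
    intro x hx
    have : S x = ∫ y in (0 : ℝ)..x, (1 : ℝ) := by
      refine intervalIntegral.integral_congr fun y hy => ?_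
      rw [uIcc_of_ge hx] at hy
      simp [hD, max_eq_right hy.2, Real.zero_rpow hr.ne']
    rw [this]; simp
  have hanti : ∀ x > 0, ∀ y ≥ x, S y + y ^ (-(1 / (p - 1))) ≤ S x + x ^ (-(1 / (p - 1))) := by
    have hB : AntitoneOn (fun x => S x + x ^ (-(1 / (p - 1)))) (Ioi 0) := by
      have hBd : ∀ x ∈ Ioi (0 : ℝ), HasDerivAt (fun x => S x + x ^ (-(1 / (p - 1))))
          ((D x)⁻¹ + -(1 / (p - 1)) * x ^ (-(1 / (p - 1)) - 1)) x := fun x hx =>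
        (hder x).add (Real.hasDerivAt_rpow_const (Or.inl (ne_of_gt hx)))
      refine antitoneOn_of_deriv_nonpos (convex_Ioi 0)
        (fun x hx => (hBd x hx).continuousAt.continuousWithinAt)
        (fun x hx => ?_) fun x hx => ?_
      · rw [interior_Ioi] at hx
        exact (hBd x hx).differentiableAt.differentiableWithinAt
      · rw [interior_Ioi] at hx
        rw [(hBd x hx).deriv]
        have hx0 : 0 < x := hx
        have he : -(1 / (p - 1)) - 1 = -(p / (p - 1)) := by field_simp; ring
        have hxp : 0 < x ^ (p / (p - 1)) := Real.rpow_pos_of_pos hx0 _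
        rw [he, Real.rpow_neg hx0.le]
        have h1 : (D x)⁻¹ ≤ ((p - 1) * x ^ (p / (p - 1)))⁻¹ := by
          refine inv_anti₀ (by positivity) ?_
          simp only [hD, max_eq_left hx0.le]; linarith
        rw [mul_inv] at h1
        have h2 : -(1 / (p - 1)) * (x ^ (p / (p - 1)))⁻¹
          = -((p - 1)⁻¹ * (x ^ (p / (p - 1)))⁻¹) := by rw [one_div]; ring
        rw [h2]; linarith
    intro x hx y hy
    exact hB hx (lt_of_lt_of_le hx hy) hy
  have hbdd : BddAbove (range S) := by
    refine ⟨S 1 + 1, ?_⟩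
    rintro _ ⟨x, rfl⟩
    rcases le_total x 1 with h | h
    · have := hmono.monotone h; linarith
    · have h1 := hanti 1 one_pos x h
      have h2 : 0 ≤ x ^ (-(1 / (p - 1))) := Real.rpow_nonneg (by linarith) _
      rw [Real.one_rpow] at h1; linarith
  refine ⟨⨆ x, S x, S, hmono, hS0, fun x => ?_, fun y hy => ?_, fun x hx => ?_, hder⟩
  · exact (hmono (lt_add_one x)).trans_le (le_ciSup hbdd _)
  · obtain ⟨x₁, hx₁⟩ := exists_lt_of_lt_ciSup hy
    refine mem_range_of_exists_le_of_exists_ge hSc ⟨min 0 y, ?_⟩ ⟨x₁, hx₁.le⟩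
    rw [hneg _ (min_le_left _ _)]; exact min_le_right _ _
  · refine ciSup_le fun y => ?_
    have hx' : 0 ≤ x ^ (-(1 / (p - 1))) := Real.rpow_nonneg (le_of_lt hx) _
    rcases le_total y x with h | h
    · have := hmono.monotone h; linarith
    · have h1 := hanti x hx y h
      have h2 : 0 ≤ y ^ (-(1 / (p - 1))) := Real.rpow_nonneg ((le_of_lt hx).trans h) _
      linarith

lemma exists_isSineProfile {p : ℝ} (hp : 1 < p) :
    ∃ (M : ℝ) (g s : ℝ → ℝ), IsSineProfile p M g s := by
  obtain ⟨M, S, hmono, hS0, hlt, hsurj, hest, hder⟩ := exists_riccati_time hp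
  have hp1 : 0 < p - 1 := by linarith
  have hr : 1 < p / (p - 1) := by rw [lt_div_iff₀ hp1]; linarith
  have hM : 0 < M := hS0 ▸ hlt 0
  have hsurj' : ∀ y, ∃ x, y < M → S x = y := fun y => by
    by_cases h : y < M
    · obtain ⟨x, hx⟩ := hsurj y h; exact ⟨x, fun _ => hx⟩
    · exact ⟨0, fun h' => absurd h' h⟩
  choose G hG using hsurj'
  have hGS : ∀ x, G (S x) = x := fun x => hmono.injective (hG _ (hlt x))
  have hGmono : StrictMonoOn G (Iio M) := fun x hx y hy hxy => by
    rw [← hmono.lt_iff_lt, hG x hx, hG y hy]; exact hxy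
  have hGc : ∀ y < M, ContinuousAt G y := fun y hy => by
    refine hGmono.continuousAt_of_image_mem_nhds (Iio_mem_nhds hy) ?_
    have : G '' Iio M = univ := eq_univ_of_forall fun x => ⟨S x, hlt x, hGS x⟩
    rw [this]; exact univ_mem
  set D : ℝ → ℝ := fun x => 1 + (p - 1) * (max x 0) ^ (p / (p - 1)) with hD
  have hDge : ∀ x, 1 ≤ D x := fun x => by
    have : 0 ≤ (p - 1) * (max x 0) ^ (p / (p - 1)) :=
      mul_nonneg hp1.le (Real.rpow_nonneg (le_max_right _ _) _)
    simp only [hD]; linarith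
  have hDpos : ∀ x, 0 < D x := fun x => one_pos.trans_le (hDge x)
  have hGder : ∀ y < M, HasDerivAt G (D (G y)) y := fun y hy => by
    have := HasDerivAt.of_local_left_inverse (hGc y hy) (hder (G y))
      (inv_pos.2 (hDpos _)).ne' (by filter_upwards [Iio_mem_nhds hy] with z hz using hG z hz)
    rwa [inv_inv] at this
  set g : ℝ → ℝ := fun t => G (M - t) with hg
  set s : ℝ → ℝ := fun t => if t = 0 then 0 else (D (g t)) ^ (-(1 / p)) with hs
  have hgder : ∀ t > 0, HasDerivAt g (-(D (g t))) t := fun t ht => by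
    have := (hGder (M - t) (by linarith)).comp_const_sub M t
    exact this
  have hgM : g M = 0 := by
    have := hGS 0; rw [hS0] at this; simp [hg, this]
  have hgpos : ∀ t ∈ Ioo 0 M, 0 < g t := fun t ht => by
    rw [← hmono.lt_iff_lt, hS0]
    simp only [hg]; rw [hG _ (by linarith [ht.1])]; linarith [ht.2]
  have hgnn : ∀ t ∈ Ioc 0 M, 0 ≤ g t := fun t ht => by
    rcases ht.2.eq_or_lt with h | h
    · rw [h, hgM]
    · exact (hgpos t ⟨ht.1, h⟩).le
  have hDg : ∀ t ∈ Ioc 0 M, D (g t) = 1 + (p - 1) * g t ^ (p / (p - 1)) := fun t ht => by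
    simp only [hD, max_eq_left (hgnn t ht)]
  have hsder : ∀ t ∈ Ioc 0 M, HasDerivAt s (s t * g t ^ (1 / (p - 1))) t := fun t ht => by
    have hD' := ((hasDerivAt_max_zero_rpow hr (g t)).comp t (hgder t ht.1)).const_mul (p - 1)
      |>.const_add 1
    have h1 : HasDerivAt (fun t => (D (g t)) ^ (-(1 / p))) _ t :=
      HasDerivAt.rpow_const (p := -(1 / p)) hD' (Or.inl (hDpos (g t)).ne')
    have h2 : s =ᶠ[𝓝 t] fun t => (D (g t)) ^ (-(1 / p)) := by
      filter_upwards [lt_mem_nhds ht.1] with y hy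
      simp only [hs]; rw [if_neg hy.ne']
    refine (h1.congr_of_eventuallyEq h2).congr_deriv ?_
    have h3 : s t = (D (g t)) ^ (-(1 / p)) := by simp only [hs]; rw [if_neg ht.1.ne']
    have h4 : (D (g t)) ^ (-(1 / p)) = (D (g t)) ^ (-(1 / p) - 1) * D (g t) := by
      rw [← Real.rpow_add_one (hDpos _).ne']; ring_nf
    have h5 : p / (p - 1) - 1 = 1 / (p - 1) := by field_simp; ring
    rw [h3, h4, h5, max_eq_left (hgnn t ht)]
    change (p - 1) * (p / (p - 1) * g t ^ (1 / (p - 1)) * -D (g t)) * -(1 / p) *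
      (D (g t)) ^ (-(1 / p) - 1) = _
    field_simp
  refine ⟨M, g, s, hM, hgM, hgpos, fun t ht => ?_, fun t ht => ?_, by simp [hs], ?_, fun t ht => ?_,
    fun t ht => ?_, hsder, fun t ht => ?_⟩
  · have h0 := hgpos t ht
    have h1 := hest (g t) h0
    have h2 : S (g t) = M - t := hG _ (by linarith [ht.1])
    have h3 : t ≤ (g t) ^ (-(1 / (p - 1))) := by linarith
    have h4 := Real.rpow_le_rpow_of_nonpos ht.1 h3 (show -(p - 1) ≤ 0 by linarith)
    rw [← Real.rpow_mul h0.le] at h4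
    have h5 : -(1 / (p - 1)) * -(p - 1) = 1 := by field_simp
    rwa [h5, Real.rpow_one] at h4
  · rw [← hDg t ht]; exact hgder t ht.1
  · simp only [hs]; rw [if_neg hM.ne', hgM]
    simp [hD, Real.zero_rpow (show p / (p - 1) ≠ 0 by linarith)]
  · simp only [hs]; rw [if_neg ht.1.ne']; exact Real.rpow_pos_of_pos (hDpos _) _
  · rcases ht.1.eq_or_lt with h | h
    · rw [← h]
      have hgt : Tendsto g (𝓝[>] 0) atTop := by
        refine tendsto_atTop.2 fun x => ?_
        have hx : 0 < M - S x := by linarith [hlt x]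
        filter_upwards [Ioo_mem_nhdsGT hx] with t ht
        rw [← hmono.le_iff_le]
        simp only [hg]; rw [hG _ (by linarith [ht.1])]; linarith [ht.2]
      have hDt : Tendsto (fun t => D (g t)) (𝓝[>] 0) atTop := by
        refine tendsto_atTop_add_const_left _ _ (Tendsto.const_mul_atTop hp1 ?_)
        refine (tendsto_rpow_atTop (by linarith)).comp (tendsto_atTop_mono (fun t => le_max_left _ _) hgt)
      have h1 : Tendsto (fun t => (D (g t)) ^ (-(1 / p))) (𝓝[>] 0) (𝓝 0) :=
        (tendsto_rpow_neg_atTop (by positivity)).comp hDt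
      have h2 : ContinuousWithinAt s (Ioi 0) 0 := by
        have : s 0 = 0 := by simp [hs]
        rw [ContinuousWithinAt, this]
        refine h1.congr' ?_
        filter_upwards [self_mem_nhdsWithin] with t ht
        simp only [hs]; rw [if_neg (ne_of_gt ht)]
      have h3 := h2.insert
      rw [Ioi_insert] at h3
      exact h3.mono fun x hx => hx.1
    · exact (hsder t ⟨h, ht.2⟩).continuousAt.continuousWithinAt
  · have h3 : s t = (D (g t)) ^ (-(1 / p)) := by simp only [hs]; rw [if_neg ht.1.ne']
    have hp0 : 0 < p := by linarith
    rw [Real.mul_rpow (h3 ▸ Real.rpow_nonneg (hDpos _).le _) (Real.rpow_nonneg (hgnn t ht) _), h3,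
      ← Real.rpow_mul (hDpos _).le, ← Real.rpow_mul (hgnn t ht)]
    have e1 : -(1 / p) * p = -1 := by field_simp
    have e2 : 1 / (p - 1) * p = p / (p - 1) := by field_simp
    rw [e1, e2, Real.rpow_neg_one, inv_mul_le_iff₀ (hDpos _), hDg t ht]
    field_simp
    linarith

/-- `w` is the primitive of `w' ∈ L^p(0, M)` vanishing at `0`. -/
structure IsHalfAdmissible (p M : ℝ) (w w' : ℝ → ℝ) : Prop where
  integrable : IntervalIntegrable w' volume 0 M
  eq_integral : ∀ t ∈ Icc 0 M, w t = ∫ r in (0 : ℝ)..t, w' r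
  integrable_rpow : IntervalIntegrable (fun t => |w' t| ^ p) volume 0 M

/-- Density of the anisotropic energy minus the `p`-mass, on the set where `w` is positive. -/
def halfDensity (p κ : ℝ) (w w' : ℝ → ℝ) (t : ℝ) : ℝ :=
  (if 0 < w t then (max (w' t) 0 + κ * max (-w' t) 0) ^ p else 0) - (max (w t) 0) ^ p

/-- Picone-type remainder of the calibration `g`. -/
def piconeDefect (p κ : ℝ) (g w w' : ℝ → ℝ) (t : ℝ) : ℝ :=
  if 0 < w t then
    (max (w' t) 0 + κ * max (-w' t) 0) ^ p -
      (p * (w t * g t ^ (1 / (p - 1))) ^ (p - 1) * w' t -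
        (p - 1) * (w t * g t ^ (1 / (p - 1))) ^ p)
  else 0

lemma max_rpow_le_asymm {p κ : ℝ} (hp : 1 < p) (hκ : 0 ≤ κ) (v : ℝ) :
    (max v 0) ^ p ≤ (max v 0 + κ * max (-v) 0) ^ p := by
  refine Real.rpow_le_rpow (le_max_right _ _) ?_ (by linarith)
  have : 0 ≤ κ * max (-v) 0 := mul_nonneg hκ (le_max_right _ _)
  linarith

lemma piconeDefect_nonneg {p κ : ℝ} (hp : 1 < p) (hκ : 0 ≤ κ) {g : ℝ → ℝ} {t : ℝ}
    (hg : 0 ≤ g t) (w w' : ℝ → ℝ) : 0 ≤ piconeDefect p κ g w w' t := by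
  unfold piconeDefect
  split_ifs with h
  · exact sub_nonneg.2 ((rpow_tangent_le hp (mul_nonneg h.le (Real.rpow_nonneg hg _))).trans
      (max_rpow_le_asymm hp hκ _))
  · exact le_rfl

lemma piconeDefect_eq_zero_iff {p κ : ℝ} (hp : 1 < p) (hκ : 0 ≤ κ) {g : ℝ → ℝ} {t : ℝ}
    (hg : 0 < g t) (w w' : ℝ → ℝ) : piconeDefect p κ g w w' t = 0 ↔
      (0 < w t → w' t = w t * g t ^ (1 / (p - 1))) := by
  unfold piconeDefect
  split_ifs with h
  · have hy : 0 < w t * g t ^ (1 / (p - 1)) := mul_pos h (Real.rpow_pos_of_pos hg _)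
    constructor
    · intro h0 _
      by_contra hne
      have h1 := rpow_tangent_lt hp hy hne
      have h2 := max_rpow_le_asymm hp hκ (w' t)
      linarith
    · intro h0
      rw [h0 h, rpow_tangent_eq hy, max_eq_right (a := -(w t * g t ^ (1 / (p - 1)))) (by linarith),
        mul_zero, add_zero, sub_self]
  · simp [h]

namespace IsHalfAdmissible

variable {p M κ : ℝ} {g s w w' : ℝ → ℝ}

lemma absolutelyContinuous (hM : 0 < M) (hw : IsHalfAdmissible p M w w') :
    AbsolutelyContinuousOnInterval w 0 M :=
  (hw.integrable.absolutelyContinuousOnInterval_intervalIntegral left_mem_uIcc).congr_on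
    fun t ht => hw.eq_integral t (by rwa [uIcc_of_le hM.le] at ht)

lemma ae_hasDerivAt (hM : 0 < M) (hw : IsHalfAdmissible p M w w') :
    ∀ᵐ t, t ∈ Ioo 0 M → HasDerivAt w (w' t) t := by
  filter_upwards [hw.integrable.ae_hasDerivAt_integral] with t ht htm
  have ht' : t ∈ uIcc 0 M := by rw [uIcc_of_le hM.le]; exact Ioo_subset_Icc_self htm
  refine (ht ht' 0 left_mem_uIcc).congr_of_eventuallyEq ?_
  filter_upwards [Ioo_mem_nhds htm.1 htm.2] with y hy
  exact hw.eq_integral y (Ioo_subset_Icc_self hy)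

lemma integrable_halfDensity (hM : 0 < M) (hp : 1 < p) (hκ : 0 ≤ κ) (hw : IsHalfAdmissible p M w w') :
    IntervalIntegrable (halfDensity p κ w w') volume 0 M := by
  have hcont : ContinuousOn w (Icc 0 M) := by
    have := (hw.absolutelyContinuous hM).continuousOn
    rwa [uIcc_of_le hM.le] at this
  refine IntervalIntegrable.sub ?_ ?_
  · have h1 := hw.integrable_rpow
    rw [intervalIntegrable_iff_integrableOn_Ioc_of_le hM.le] at h1 ⊢
    have hw'm : AEStronglyMeasurable w' (volume.restrict (Ioc 0 M)) :=
      ((intervalIntegrable_iff_integrableOn_Ioc_of_le hM.le).1 hw.integrable).aestronglyMeasurable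
    have hwm : AEMeasurable w (volume.restrict (Ioc 0 M)) :=
      ((hcont.mono Ioc_subset_Icc_self).aestronglyMeasurable measurableSet_Ioc).aemeasurable
    have hset : NullMeasurableSet {t | 0 < w t} (volume.restrict (Ioc 0 M)) :=
      nullMeasurableSet_lt aemeasurable_const hwm
    have hm : AEStronglyMeasurable (fun t => (max (w' t) 0 + κ * max (-w' t) 0) ^ p)
        (volume.restrict (Ioc 0 M)) :=
      (((hw'm.aemeasurable.max aemeasurable_const).add
        ((hw'm.aemeasurable.neg.max aemeasurable_const).const_mul κ)).pow_const p).aestronglyMeasurable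
    refine Integrable.mono' (h1.const_mul ((1 + κ) ^ p)) (hm.indicator₀ hset) (ae_of_all _ fun t => ?_)
    have hnn : 0 ≤ (1 + κ) ^ p * |w' t| ^ p := by positivity
    by_cases h : 0 < w t
    · rw [if_pos h, Real.norm_eq_abs,
        abs_of_nonneg (by positivity)]
      rw [← Real.mul_rpow (by positivity) (abs_nonneg _)]
      refine Real.rpow_le_rpow (by positivity) ?_ (by linarith)
      have h1 : max (w' t) 0 ≤ |w' t| := max_le (le_abs_self _) (abs_nonneg _)
      have h2 : max (-w' t) 0 ≤ |w' t| := max_le (neg_le_abs _) (abs_nonneg _)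
      have h3 := mul_le_mul_of_nonneg_left h2 hκ
      linarith
    · rw [if_neg h, norm_zero]; exact hnn
  · refine ContinuousOn.intervalIntegrable ?_
    rw [uIcc_of_le hM.le]
    exact (hcont.sup continuousOn_const).rpow_const fun x _ => Or.inr (by linarith)

/-- Hölder-type bound at the vanishing endpoint. -/
lemma max_rpow_le (hp : 1 < p) (hw : IsHalfAdmissible p M w w') {t : ℝ} (ht : t ∈ Ioc 0 M) :
    (max (w t) 0) ^ p ≤ t ^ (p - 1) * ∫ r in (0 : ℝ)..t, |w' r| ^ p := by
  have hsub : uIcc 0 t ⊆ uIcc 0 M := by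
    rw [uIcc_of_le ht.1.le, uIcc_of_le (ht.1.le.trans ht.2)]; exact Icc_subset_Icc_right ht.2
  have hi1 : IntervalIntegrable w' volume 0 t := hw.integrable.mono_set hsub
  have hi2 : IntervalIntegrable (fun t => |w' t| ^ p) volume 0 t :=
    hw.integrable_rpow.mono_set hsub
  set y := (max (w t) 0) / t with hy
  have hy0 : 0 ≤ y := div_nonneg (le_max_right _ _) ht.1.le
  have hwt : max (w t) 0 = t * y := by rw [hy]; field_simp [ht.1.ne']
  have h_tangent : ∫ r in (0 : ℝ)..t, (p * y ^ (p - 1) * w' r - (p - 1) * y ^ p) ≤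
      ∫ r in (0 : ℝ)..t, |w' r| ^ p := by
    refine intervalIntegral.integral_mono_on ht.1.le
      ((hi1.const_mul _).sub intervalIntegrable_const) hi2 fun r _ => ?_
    exact (rpow_tangent_le hp hy0).trans (Real.rpow_le_rpow (le_max_right _ _)
      (max_le (le_abs_self _) (abs_nonneg _)) (by linarith))
  rw [intervalIntegral.integral_sub (hi1.const_mul _) intervalIntegrable_const,
    intervalIntegral.integral_const_mul, ← hw.eq_integral t ⟨ht.1.le, ht.2⟩,
    intervalIntegral.integral_const, smul_eq_mul, sub_zero] at h_tangent
  have htp : t ^ p = t ^ (p - 1) * t := by rw [← Real.rpow_add_one ht.1.ne']; ring_nf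
  have key : t * y ^ p ≤ ∫ r in (0 : ℝ)..t, |w' r| ^ p := by
    refine le_trans (le_of_eq ?_) h_tangent
    rcases hy0.eq_or_lt with h | h
    · rw [← h, Real.zero_rpow (by linarith), Real.zero_rpow (by linarith)]; ring
    · have hwpos : max (w t) 0 = w t := by
        refine max_eq_left ?_
        by_contra hneg
        rw [hy, max_eq_right (not_le.1 hneg).le, zero_div] at h
        exact lt_irrefl _ h
      rw [hwpos] at hwt
      have hyp : y ^ p = y ^ (p - 1) * y := by rw [← Real.rpow_add_one h.ne']; ring_nf
      rw [hwt, hyp]; ring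
  rw [hwt, Real.mul_rpow ht.1.le hy0, htp, mul_assoc]
  gcongr
  exact Real.rpow_nonneg ht.1.le _

variable (hg : IsSineProfile p M g s)
include hg

lemma integral_piconeDefect (hp : 1 < p) (hκ : 0 ≤ κ) (hw : IsHalfAdmissible p M w w') {ε : ℝ}
    (hε : ε ∈ Ioo 0 M) : IntervalIntegrable (piconeDefect p κ g w w') volume ε M ∧
      ∫ t in ε..M, piconeDefect p κ g w w' t =
        (∫ t in ε..M, halfDensity p κ w w' t) + (max (w ε) 0) ^ p * g ε := by
  have hM := hg.quarter_pos
  have hp1 : 0 < p - 1 := by linarith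
  have hr : 0 < p / (p - 1) := by positivity
  have hsub : uIcc ε M ⊆ uIcc 0 M := by
    rw [uIcc_of_le hε.2.le, uIcc_of_le hM.le]; exact Icc_subset_Icc_left hε.1.le
  have hIcc : Icc ε M ⊆ Ioc 0 M := fun t ht => ⟨hε.1.trans_le ht.1, ht.2⟩
  have hgc : ContinuousOn g (Icc ε M) := fun t ht =>
    (hg.g_deriv t (hIcc ht)).continuousAt.continuousWithinAt
  have hgAC : AbsolutelyContinuousOnInterval g ε M :=
    absolutelyContinuousOnInterval_of_hasDerivAt hε.2.le (fun t ht => hg.g_deriv t (hIcc ht))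
      (((hgc.rpow_const fun x _ => Or.inr hr.le).const_smul (p - 1)).const_add 1).neg
  have hF : AbsolutelyContinuousOnInterval (fun t => (max (w t) 0) ^ p * g t) ε M :=
    (((hw.absolutelyContinuous hM).mono hsub).max_zero_rpow hp).fun_mul hgAC
  have hX : IntervalIntegrable (halfDensity p κ w w') volume ε M :=
    (hw.integrable_halfDensity hM hp hκ).mono_set hsub
  have hDI := hF.intervalIntegrable_deriv
  have hae : ∀ᵐ t, t ∈ uIoc ε M → halfDensity p κ w w' t -
      deriv (fun t => (max (w t) 0) ^ p * g t) t = piconeDefect p κ g w w' t := by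
    have hne : ∀ᵐ t : ℝ, t ≠ M := by simp [ae_iff, measure_singleton]
    filter_upwards [hw.ae_hasDerivAt hM, hne] with t ht htM htm
    rw [uIoc_of_le hε.2.le] at htm
    have htI : t ∈ Ioo 0 M := ⟨hε.1.trans htm.1, lt_of_le_of_ne htm.2 htM⟩
    have hgt := hg.g_pos t htI
    have hd := (((hasDerivAt_max_zero_rpow hp (w t)).comp t (ht htI)).mul
      (hg.g_deriv t ⟨htI.1, htI.2.le⟩)).deriv
    change deriv (fun t => (max (w t) 0) ^ p * g t) t = _ at hd
    rw [hd]
    unfold halfDensity piconeDefect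
    simp only [Function.comp]
    split_ifs with h
    · rw [max_eq_left h.le, Real.mul_rpow h.le (Real.rpow_nonneg hgt.le _),
        Real.mul_rpow h.le (Real.rpow_nonneg hgt.le _), ← Real.rpow_mul hgt.le,
        ← Real.rpow_mul hgt.le]
      have e1 : 1 / (p - 1) * (p - 1) = 1 := by field_simp
      have e2 : 1 / (p - 1) * p = p / (p - 1) := by field_simp
      rw [e1, e2, Real.rpow_one]
      ring
    · rw [max_eq_right (not_lt.1 h), Real.zero_rpow (by linarith), Real.zero_rpow hp1.ne']
      ring
  have hae' : (fun t => halfDensity p κ w w' t - deriv (fun t => (max (w t) 0) ^ p * g t) t)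
      =ᵐ[volume.restrict (uIoc ε M)] piconeDefect p κ g w w' :=
    (ae_restrict_iff' measurableSet_uIoc).2 hae
  refine ⟨(hX.sub hDI).congr_ae hae', ?_⟩
  rw [← intervalIntegral.integral_congr_ae hae, intervalIntegral.integral_sub hX hDI,
    hF.integral_deriv_eq_sub, hg.g_end]
  ring

lemma tendsto_integral_piconeDefect (hp : 1 < p) (hκ : 0 ≤ κ) (hw : IsHalfAdmissible p M w w') :
    Tendsto (fun ε => ∫ t in ε..M, piconeDefect p κ g w w' t) (𝓝[>] 0)
      (𝓝 (∫ t in (0 : ℝ)..M, halfDensity p κ w w' t)) := by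
  have hM := hg.quarter_pos
  have hX := hw.integrable_halfDensity hM hp hκ
  have hprim : ∀ f : ℝ → ℝ, IntervalIntegrable f volume 0 M →
      Tendsto (fun ε => ∫ t in (0 : ℝ)..ε, f t) (𝓝[>] 0) (𝓝 0) := fun f hf => by
    have h1 : ContinuousOn (fun ε => ∫ t in (0 : ℝ)..ε, f t) (Icc 0 M) := by
      rw [← uIcc_of_le hM.le]
      exact intervalIntegral.continuousOn_primitive_interval
        (by rw [uIcc_of_le hM.le]; exact (intervalIntegrable_iff_integrableOn_Icc_of_le hM.le).1 hf)
    have h2 := (h1 0 ⟨le_rfl, hM.le⟩).tendsto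
    rw [intervalIntegral.integral_same] at h2
    refine h2.mono_left ?_
    rw [← nhdsWithin_Ioo_eq_nhdsGT hM]
    exact nhdsWithin_mono _ Ioo_subset_Icc_self
  have hFt : Tendsto (fun ε => (max (w ε) 0) ^ p * g ε) (𝓝[>] 0) (𝓝 0) := by
    refine tendsto_of_tendsto_of_tendsto_of_le_of_le' tendsto_const_nhds
      (hprim _ hw.integrable_rpow) ?_ ?_
    · filter_upwards [Ioo_mem_nhdsGT hM] with t ht
      exact mul_nonneg (by positivity) (hg.g_pos t ht).le
    · filter_upwards [Ioo_mem_nhdsGT hM] with t ht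
      have h_tangent : 0 ≤ ∫ r in (0 : ℝ)..t, |w' r| ^ p :=
        intervalIntegral.integral_nonneg ht.1.le fun r _ => by positivity
      have htp : 0 < t ^ (p - 1) := Real.rpow_pos_of_pos ht.1 _
      calc _ ≤ (t ^ (p - 1) * ∫ r in (0 : ℝ)..t, |w' r| ^ p) * t ^ (-(p - 1)) :=
            mul_le_mul (hw.max_rpow_le hp ⟨ht.1, ht.2.le⟩) (hg.g_le t ht) (hg.g_pos t ht).le
              (mul_nonneg htp.le h_tangent)
        _ = _ := by rw [Real.rpow_neg ht.1.le]; field_simp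
  have h : Tendsto (fun ε => ((∫ t in (0 : ℝ)..M, halfDensity p κ w w' t) -
      ∫ t in (0 : ℝ)..ε, halfDensity p κ w w' t) + (max (w ε) 0) ^ p * g ε) (𝓝[>] 0)
      (𝓝 (((∫ t in (0 : ℝ)..M, halfDensity p κ w w' t) - 0) + 0)) :=
    (tendsto_const_nhds.sub (hprim _ hX)).add hFt
  rw [sub_zero, add_zero] at h
  refine h.congr' ?_
  filter_upwards [Ioo_mem_nhdsGT hM] with ε hε
  rw [(hw.integral_piconeDefect hg hp hκ hε).2]
  have hsub1 : uIcc 0 ε ⊆ uIcc 0 M := by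
    rw [uIcc_of_le hε.1.le, uIcc_of_le hM.le]; exact Icc_subset_Icc_right hε.2.le
  rw [← intervalIntegral.integral_interval_sub_left hX (hX.mono_set hsub1)]

lemma piconeDefect_nonneg_of_mem (hp : 1 < p) (hκ : 0 ≤ κ) {t : ℝ} (ht : t ∈ Ioc 0 M) :
    0 ≤ piconeDefect p κ g w w' t := by
  refine piconeDefect_nonneg hp hκ ?_ w w'
  rcases ht.2.eq_or_lt with h | h
  · rw [h, hg.g_end]
  · exact (hg.g_pos t ⟨ht.1, h⟩).le

/-- Sharp one-sided Poincaré inequality. -/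
lemma integral_halfDensity_nonneg (hp : 1 < p) (hκ : 0 ≤ κ) (hw : IsHalfAdmissible p M w w') :
    0 ≤ ∫ t in (0 : ℝ)..M, halfDensity p κ w w' t := by
  refine ge_of_tendsto (hw.tendsto_integral_piconeDefect hg hp hκ) ?_
  filter_upwards [Ioo_mem_nhdsGT hg.quarter_pos] with ε hε
  exact intervalIntegral.integral_nonneg hε.2.le fun t ht =>
    piconeDefect_nonneg_of_mem hg hp hκ ⟨hε.1.trans_le ht.1, ht.2⟩

lemma ae_eq_of_integral_eq_zero (hp : 1 < p) (hκ : 0 ≤ κ) (hw : IsHalfAdmissible p M w w')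
    (h0 : ∫ t in (0 : ℝ)..M, halfDensity p κ w w' t = 0) {δ : ℝ} (hδ : δ ∈ Ioo 0 M) :
    ∀ᵐ t, t ∈ Ioo δ M → 0 < w t → w' t = w t * g t ^ (1 / (p - 1)) := by
  have hlim := hw.tendsto_integral_piconeDefect hg hp hκ
  rw [h0] at hlim
  have hnn : ∀ ε ∈ Ioo 0 M, ∀ t ∈ Icc ε M, 0 ≤ piconeDefect p κ g w w' t := fun ε hε t ht =>
    piconeDefect_nonneg_of_mem hg hp hκ ⟨hε.1.trans_le ht.1, ht.2⟩
  have hI := fun ε (hε : ε ∈ Ioo 0 M) => (hw.integral_piconeDefect hg hp hκ hε).1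
  have hle : ∫ t in δ..M, piconeDefect p κ g w w' t ≤ 0 := by
    refine ge_of_tendsto hlim ?_
    filter_upwards [Ioo_mem_nhdsGT hδ.1] with ε hε
    have hε' : ε ∈ Ioo 0 M := ⟨hε.1, hε.2.trans hδ.2⟩
    refine intervalIntegral.integral_mono_interval hε.2.le hδ.2.le le_rfl ?_ (hI ε hε')
    refine (ae_restrict_iff' measurableSet_Ioc).2 (ae_of_all _ fun t ht => ?_)
    exact hnn ε hε' t (Ioc_subset_Icc_self ht)
  have hzero : ∫ t in δ..M, piconeDefect p κ g w w' t = 0 :=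
    le_antisymm hle (intervalIntegral.integral_nonneg hδ.2.le (hnn δ hδ))
  have hae := (intervalIntegral.integral_eq_zero_iff_of_le_of_nonneg_ae hδ.2.le
    ((ae_restrict_iff' measurableSet_Ioc).2 (ae_of_all _ fun t ht =>
      hnn δ hδ t (Ioc_subset_Icc_self ht))) (hI δ hδ)).1 hzero
  have hae' := (ae_restrict_iff' measurableSet_Ioc).1 hae
  filter_upwards [hae'] with t ht htm
  exact (piconeDefect_eq_zero_iff hp hκ (hg.g_pos t ⟨hδ.1.trans htm.1, htm.2⟩) w w').1
    (ht (Ioo_subset_Ioc_self htm))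

/-- Equality case of the sharp one-sided Poincaré inequality. -/
lemma eq_of_integral_eq_zero (hp : 1 < p) (hκ : 0 ≤ κ) (hw : IsHalfAdmissible p M w w')
    (h0 : ∫ t in (0 : ℝ)..M, halfDensity p κ w w' t = 0) :
    ∀ t ∈ Icc 0 M, max (w t) 0 = max (w M) 0 * s t := by
  have hM := hg.quarter_pos
  have hp1 : 0 < p - 1 := by linarith
  intro δ hδ
  rcases hδ.1.eq_or_lt with h | hδ0
  · rw [← h, hg.s_zero, mul_zero, hw.eq_integral 0 ⟨le_rfl, hM.le⟩]; simp
  rcases hδ.2.eq_or_lt with h | hδM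
  · rw [h, hg.s_end, mul_one]
  have hsub : uIcc δ M ⊆ uIcc 0 M := by
    rw [uIcc_of_le hδM.le, uIcc_of_le hM.le]; exact Icc_subset_Icc_left hδ0.le
  have hIcc : Icc δ M ⊆ Ioc 0 M := fun t ht => ⟨hδ0.trans_le ht.1, ht.2⟩
  have hgc : ContinuousOn g (Icc δ M) := fun t ht =>
    (hg.g_deriv t (hIcc ht)).continuousAt.continuousWithinAt
  have hsc : ContinuousOn s (Icc δ M) := hg.s_cont.mono (Icc_subset_Icc_left hδ0.le)
  have hσd : ∀ t ∈ Icc δ M, HasDerivAt (fun t => s t ^ (-p))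
      (s t * g t ^ (1 / (p - 1)) * (-p) * s t ^ (-p - 1)) t := fun t ht =>
    (hg.s_deriv t (hIcc ht)).rpow_const (Or.inl (hg.s_pos t (hIcc ht)).ne')
  have hσ : AbsolutelyContinuousOnInterval (fun t => s t ^ (-p)) δ M := by
    refine absolutelyContinuousOnInterval_of_hasDerivAt hδM.le hσd ?_
    refine ((hsc.mul (hgc.rpow_const fun x _ => Or.inr (by positivity))).mul
      continuousOn_const).mul (hsc.rpow_const fun x hx => Or.inl (hg.s_pos x (hIcc hx)).ne')
  have hF : AbsolutelyContinuousOnInterval (fun t => (max (w t) 0) ^ p * s t ^ (-p)) δ M :=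
    (((hw.absolutelyContinuous hM).mono hsub).max_zero_rpow hp).fun_mul hσ
  have hconst := hF.const_of_ae_hasDerivAt_zero (by
    have hne : ∀ᵐ t : ℝ, t ≠ M := by simp [ae_iff, measure_singleton]
    have hne' : ∀ᵐ t : ℝ, t ≠ δ := by simp [ae_iff, measure_singleton]
    filter_upwards [hw.ae_hasDerivAt hM, hw.ae_eq_of_integral_eq_zero hg hp hκ h0 ⟨hδ0, hδM⟩,
      hne, hne'] with t ht1 ht2 htM htδ htm
    rw [uIcc_of_le hδM.le] at htm
    have htI : t ∈ Ioo δ M := ⟨lt_of_le_of_ne htm.1 htδ.symm, lt_of_le_of_ne htm.2 htM⟩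
    refine (((hasDerivAt_max_zero_rpow hp (w t)).comp t (ht1 ⟨hδ0.trans htI.1, htI.2⟩)).mul
      (hσd t htm)).congr_deriv ?_
    simp only [Function.comp]
    rcases le_or_gt (w t) 0 with h | h
    · rw [max_eq_right h, Real.zero_rpow (show p ≠ 0 by linarith), Real.zero_rpow hp1.ne']; ring
    · have hs := hg.s_pos t (hIcc htm)
      have e1 : w t ^ p = w t ^ (p - 1) * w t := by rw [← Real.rpow_add_one h.ne']; ring_nf
      have e2 : s t ^ (-p) = s t ^ (-p - 1) * s t := by rw [← Real.rpow_add_one hs.ne']; ring_nf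
      rw [max_eq_left h.le, ht2 htI h, e1, e2]; ring)
  obtain ⟨C, hC⟩ := hconst
  have h1 := hC δ left_mem_uIcc
  have h2 := hC M right_mem_uIcc
  rw [hg.s_end, Real.one_rpow, mul_one] at h2
  have hs := hg.s_pos δ ⟨hδ0, hδM.le⟩
  have h3 : (max (w δ) 0) ^ p = (max (w M) 0 * s δ) ^ p := by
    rw [Real.mul_rpow (le_max_right _ _) hs.le, h2, ← h1, mul_assoc, ← Real.rpow_add hs]
    simp
  exact (Real.rpow_left_inj (le_max_right _ _) (mul_nonneg (le_max_right _ _) hs.le)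
    (by linarith)).1 h3

lemma integral_eq_zero_of_eq (hp : 1 < p) (hκ : 0 ≤ κ) (hw : IsHalfAdmissible p M w w') {c : ℝ}
    (hc : ∀ t ∈ Icc 0 M, w t = c * s t) :
    ∫ t in (0 : ℝ)..M, halfDensity p κ w w' t = 0 := by
  have hM := hg.quarter_pos
  refine tendsto_nhds_unique (hw.tendsto_integral_piconeDefect hg hp hκ) ?_
  refine tendsto_const_nhds.congr' ?_
  filter_upwards [Ioo_mem_nhdsGT hM] with ε hε
  symm
  refine intervalIntegral.integral_zero_ae ?_
  have hne : ∀ᵐ t : ℝ, t ≠ M := by simp [ae_iff, measure_singleton]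
  filter_upwards [hw.ae_hasDerivAt hM, hne] with t ht htM htm
  rw [uIoc_of_le hε.2.le] at htm
  have htI : t ∈ Ioo 0 M := ⟨hε.1.trans htm.1, lt_of_le_of_ne htm.2 htM⟩
  refine (piconeDefect_eq_zero_iff hp hκ (hg.g_pos t htI) w w').2 fun _ => ?_
  have h1 : HasDerivAt w (c * (s t * g t ^ (1 / (p - 1)))) t := by
    refine ((hg.s_deriv t ⟨htI.1, htI.2.le⟩).const_mul c).congr_of_eventuallyEq ?_
    filter_upwards [Ioo_mem_nhds htI.1 htI.2] with y hy
    exact hc y (Ioo_subset_Icc_self hy)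
  rw [(ht htI).unique h1, hc t (Ioo_subset_Icc_self htI), mul_assoc]

end IsHalfAdmissible

lemma intervalIntegrable_comp_add_mul_iff {f : ℝ → ℝ} {a b c d : ℝ} (hc : c ≠ 0) :
    IntervalIntegrable (fun x => f (d + c * x)) volume a b ↔
      IntervalIntegrable f volume (d + c * a) (d + c * b) := by
  have h1 := IntervalIntegrable.comp_mul_left_iff (f := fun x => f (d + x)) (a := c * a)
    (b := c * b) hc
  rw [mul_div_cancel_left₀ _ hc, mul_div_cancel_left₀ _ hc] at h1
  rw [h1, ← IntervalIntegrable.comp_add_left_iff (f := f) (c := d), add_sub_cancel_left,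
    add_sub_cancel_left]

/-- Rescaling a Sobolev function around a zero `e` yields a half-admissible function. -/
lemma MemW1p0.isHalfAdmissible {p T M e σ : ℝ} {u u' : ℝ → ℝ} (hu : MemW1p0 p (-T) T u u')
    (hM : 0 < M) (hσ : σ ≠ 0) (he : e ∈ Icc (-T) T) (heM : e + σ * M ∈ Icc (-T) T)
    (he0 : u e = 0) :
    IsHalfAdmissible p M (fun x => u (e + σ * x)) (fun x => σ * u' (e + σ * x)) := by
  obtain ⟨⟨hi, heq, hip⟩, h0, -⟩ := hu
  have hT : -T ≤ T := he.1.trans he.2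
  have hmem : ∀ x ∈ Icc 0 M, e + σ * x ∈ Icc (-T) T := fun x hx => by
    have h := (convex_Icc (-T) T) he heM (sub_nonneg.2 ((div_le_one hM).2 hx.2))
      (div_nonneg hx.1 hM.le) (sub_add_cancel 1 (x / M))
    convert h using 1
    simp only [smul_eq_mul]
    field_simp
    ring
  have hsub : uIcc (e + σ * 0) (e + σ * M) ⊆ uIcc (-T) T := by
    rw [uIcc_of_le hT]
    exact OrdConnected.uIcc_subset ordConnected_Icc (hmem 0 ⟨le_rfl, hM.le⟩) heM
  have hip' : IntervalIntegrable (fun t => |u' t| ^ p) volume (-T) T := by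
    rwa [intervalIntegrable_iff_integrableOn_Ioo_of_le hT]
  refine ⟨((intervalIntegrable_comp_add_mul_iff hσ).2 (hi.mono_set hsub)).const_mul σ, ?_, ?_⟩
  · intro t ht
    have h1 := heq _ (hmem t ht)
    have h2 := heq e he
    have hsubI : ∀ y ∈ Icc (-T) T, IntervalIntegrable u' volume (-T) y := fun y hy =>
      hi.mono_set (by rw [uIcc_of_le hT, uIcc_of_le hy.1]; exact Icc_subset_Icc_right hy.2)
    rw [intervalIntegral.integral_const_mul, intervalIntegral.mul_integral_comp_add_mul, mul_zero,
      add_zero, ← intervalIntegral.integral_interval_sub_left (hsubI _ (hmem t ht)) (hsubI e he)]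
    linarith
  · have h := ((intervalIntegrable_comp_add_mul_iff hσ).2 (hip'.mono_set hsub)).const_mul (|σ| ^ p)
    refine h.congr fun x _ => ?_
    simp only [abs_mul]
    rw [Real.mul_rpow (abs_nonneg _) (abs_nonneg _)]

/-- Density of the asymmetric energy minus the `p`-mass, on the set where `u` is positive. -/
def asymDensity (p α β : ℝ) (u u' : ℝ → ℝ) (t : ℝ) : ℝ :=
  (if 0 < u t then (α * ppart (u' t) + β * npart (u' t)) ^ p else 0) - (max (u t) 0) ^ p

lemma asymDensity_comp_left {p α β e : ℝ} (hα : 0 < α) (u u' : ℝ → ℝ) (x : ℝ) :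
    asymDensity p α β u u' (e + α * x) =
      halfDensity p (β / α) (fun x => u (e + α * x)) (fun x => α * u' (e + α * x)) x := by
  unfold asymDensity halfDensity ppart npart
  have h1 : max (α * u' (e + α * x)) 0 = α * max (u' (e + α * x)) 0 := by
    rw [mul_max_of_nonneg _ _ hα.le, mul_zero]
  have h2 : max (-(α * u' (e + α * x))) 0 = α * max (-u' (e + α * x)) 0 := by
    rw [mul_max_of_nonneg _ _ hα.le, mul_zero, mul_neg]
  simp only [h1, h2]
  rw [← mul_assoc, div_mul_cancel₀ _ hα.ne']

lemma asymDensity_comp_right {p α β e : ℝ} (hβ : 0 < β) (u u' : ℝ → ℝ) (x : ℝ) :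
    asymDensity p α β u u' (e + -β * x) =
      halfDensity p (α / β) (fun x => u (e + -β * x)) (fun x => -β * u' (e + -β * x)) x := by
  unfold asymDensity halfDensity ppart npart
  have h1 : max (-β * u' (e + -β * x)) 0 = β * max (-u' (e + -β * x)) 0 := by
    rw [mul_max_of_nonneg _ _ hβ.le, mul_zero, neg_mul, mul_neg]
  have h2 : max (-(-β * u' (e + -β * x))) 0 = β * max (u' (e + -β * x)) 0 := by
    rw [mul_max_of_nonneg _ _ hβ.le, mul_zero, neg_mul, neg_neg]
  simp only [h1, h2]
  rw [← mul_assoc, div_mul_cancel₀ _ hβ.ne', add_comm (α * _)]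

/-- The positive extremal built from the sine profile `s`. -/
def asymProfile (α β T : ℝ) (s : ℝ → ℝ) (t : ℝ) : ℝ := s (min ((t + T) / α) ((T - t) / β))

section Global

variable {p M α β T : ℝ} {g s u u' : ℝ → ℝ}

lemma asymProfile_left (hα : 0 < α) (hβ : 0 < β) (hT : α * M + β * M = 2 * T) {x : ℝ}
    (hx : x ≤ M) : asymProfile α β T s (-T + α * x) = s x := by
  unfold asymProfile
  have h1 : (-T + α * x + T) / α = x := by field_simp; ring
  rw [h1, min_eq_left]
  rw [le_div_iff₀ hβ]
  nlinarith [mul_nonneg (add_pos hα hβ).le (sub_nonneg.2 hx)]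

lemma asymProfile_right (hα : 0 < α) (hβ : 0 < β) (hT : α * M + β * M = 2 * T) {x : ℝ}
    (hx : x ≤ M) : asymProfile α β T s (T + -β * x) = s x := by
  unfold asymProfile
  have h1 : (T - (T + -β * x)) / β = x := by field_simp; ring
  rw [h1, min_eq_right]
  rw [le_div_iff₀ hα]
  nlinarith [mul_nonneg (add_pos hα hβ).le (sub_nonneg.2 hx)]

lemma exists_eq_left_or_right (hα : 0 < α) (hβ : 0 < β)
    (hT : α * M + β * M = 2 * T) {t : ℝ} (ht : t ∈ Icc (-T) T) :
    (∃ x ∈ Icc 0 M, t = -T + α * x) ∨ ∃ x ∈ Icc 0 M, t = T + -β * x := by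
  rcases le_total t (-T + α * M) with h | h
  · refine Or.inl ⟨(t + T) / α, ⟨div_nonneg (by linarith [ht.1]) hα.le, ?_⟩, by field_simp; ring⟩
    rw [div_le_iff₀ hα]; linarith
  · refine Or.inr ⟨(T - t) / β, ⟨div_nonneg (by linarith [ht.2]) hβ.le, ?_⟩, by field_simp; ring⟩
    rw [div_le_iff₀ hβ]; linarith

lemma MemW1p0.isHalfAdmissible_left (hu : MemW1p0 p (-T) T u u') (hM : 0 < M) (hα : 0 < α)
    (hβ : 0 < β) (hT : α * M + β * M = 2 * T) :
    IsHalfAdmissible p M (fun x => u (-T + α * x)) (fun x => α * u' (-T + α * x)) := by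
  have h1 := mul_pos hα hM
  have h2 := mul_pos hβ hM
  exact hu.isHalfAdmissible hM hα.ne' ⟨le_rfl, by linarith⟩ ⟨by linarith, by linarith⟩ hu.2.1

lemma MemW1p0.isHalfAdmissible_right (hu : MemW1p0 p (-T) T u u') (hM : 0 < M) (hα : 0 < α)
    (hβ : 0 < β) (hT : α * M + β * M = 2 * T) :
    IsHalfAdmissible p M (fun x => u (T + -β * x)) (fun x => -β * u' (T + -β * x)) := by
  have h1 := mul_pos hα hM
  have h2 := mul_pos hβ hM
  exact hu.isHalfAdmissible hM (neg_ne_zero.2 hβ.ne') ⟨by linarith, le_rfl⟩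
    ⟨by linarith, by linarith⟩ hu.2.2

lemma MemW1p0.integral_asymDensity (hu : MemW1p0 p (-T) T u u') (hp : 1 < p) (hM : 0 < M)
    (hα : 0 < α) (hβ : 0 < β) (hT : α * M + β * M = 2 * T) :
    IntervalIntegrable (asymDensity p α β u u') volume (-T) T ∧
      ∫ t in (-T)..T, asymDensity p α β u u' t =
        α * (∫ x in (0 : ℝ)..M, halfDensity p (β / α) (fun x => u (-T + α * x))
          (fun x => α * u' (-T + α * x)) x) +
        β * ∫ x in (0 : ℝ)..M, halfDensity p (α / β) (fun x => u (T + -β * x))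
          (fun x => -β * u' (T + -β * x)) x := by
  have hl := (hu.isHalfAdmissible_left hM hα hβ hT).integrable_halfDensity hM hp
    (div_pos hβ hα).le
  have hr := (hu.isHalfAdmissible_right hM hα hβ hT).integrable_halfDensity hM hp
    (div_pos hα hβ).le
  have hmid : T + -β * M = -T + α * M := by linarith
  simp only [funext fun x => (asymDensity_comp_left (e := -T) (β := β) (p := p) hα u u' x).symm,
    funext fun x => (asymDensity_comp_right (e := T) (α := α) (p := p) hβ u u' x).symm]
  have hl' := (hl.congr fun x _ => (asymDensity_comp_left hα u u' x).symm)
  have hr' := (hr.congr fun x _ => (asymDensity_comp_right hβ u u' x).symm)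
  rw [intervalIntegrable_comp_add_mul_iff hα.ne', mul_zero, add_zero] at hl'
  rw [intervalIntegrable_comp_add_mul_iff (neg_ne_zero.2 hβ.ne'), mul_zero, add_zero, hmid] at hr'
  refine ⟨hl'.trans hr'.symm, ?_⟩
  rw [intervalIntegral.mul_integral_comp_add_mul, mul_zero, add_zero,
    ← intervalIntegral.integral_add_adjacent_intervals hl' hr'.symm]
  have := intervalIntegral.mul_integral_comp_add_mul (a := 0) (b := M)
    (f := asymDensity p α β u u') (-β) T
  rw [mul_zero, add_zero, hmid, intervalIntegral.integral_symm (-T + α * M) T] at this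
  linarith

variable (hg : IsSineProfile p M g s)
include hg

lemma MemW1p0.integral_asymDensity_nonneg (hu : MemW1p0 p (-T) T u u') (hp : 1 < p)
    (hα : 0 < α) (hβ : 0 < β) (hT : α * M + β * M = 2 * T) :
    0 ≤ ∫ t in (-T)..T, asymDensity p α β u u' t := by
  have hM := hg.quarter_pos
  rw [(hu.integral_asymDensity hp hM hα hβ hT).2]
  have h1 := (hu.isHalfAdmissible_left hM hα hβ hT).integral_halfDensity_nonneg hg hp
    (div_pos hβ hα).le
  have h2 := (hu.isHalfAdmissible_right hM hα hβ hT).integral_halfDensity_nonneg hg hp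
    (div_pos hα hβ).le
  positivity

lemma MemW1p0.eq_of_integral_asymDensity_eq_zero (hu : MemW1p0 p (-T) T u u') (hp : 1 < p)
    (hα : 0 < α) (hβ : 0 < β) (hT : α * M + β * M = 2 * T)
    (h0 : ∫ t in (-T)..T, asymDensity p α β u u' t = 0) :
    ∃ c, 0 ≤ c ∧ ∀ t ∈ Icc (-T) T, max (u t) 0 = c * asymProfile α β T s t := by
  have hM := hg.quarter_pos
  rw [(hu.integral_asymDensity hp hM hα hβ hT).2] at h0
  have hl := hu.isHalfAdmissible_left hM hα hβ hT
  have hr := hu.isHalfAdmissible_right hM hα hβ hT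
  have h1 := hl.integral_halfDensity_nonneg hg hp (div_pos hβ hα).le
  have h2 := hr.integral_halfDensity_nonneg hg hp (div_pos hα hβ).le
  obtain ⟨h3, h4⟩ := (add_eq_zero_iff_of_nonneg (mul_nonneg hα.le h1) (mul_nonneg hβ.le h2)).1 h0
  have h5 := hl.eq_of_integral_eq_zero hg hp (div_pos hβ hα).le
    ((mul_eq_zero.1 h3).resolve_left hα.ne')
  have h6 := hr.eq_of_integral_eq_zero hg hp (div_pos hα hβ).le
    ((mul_eq_zero.1 h4).resolve_left hβ.ne')
  refine ⟨max (u (-T + α * M)) 0, le_max_right _ _, fun t ht => ?_⟩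
  rcases exists_eq_left_or_right hα hβ hT ht with ⟨x, hx, rfl⟩ | ⟨x, hx, rfl⟩
  · rw [asymProfile_left hα hβ hT hx.2]
    exact h5 x hx
  · rw [asymProfile_right hα hβ hT hx.2, show -T + α * M = T + -β * M by linarith]
    exact h6 x hx

lemma MemW1p0.integral_asymDensity_eq_zero (hu : MemW1p0 p (-T) T u u') (hp : 1 < p)
    (hα : 0 < α) (hβ : 0 < β) (hT : α * M + β * M = 2 * T) {c : ℝ}
    (hc : ∀ t ∈ Icc (-T) T, u t = c * asymProfile α β T s t) :
    ∫ t in (-T)..T, asymDensity p α β u u' t = 0 := by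
  have hM := hg.quarter_pos
  have h1 := mul_pos hα hM
  have h2 := mul_pos hβ hM
  have hl : ∀ x ∈ Icc 0 M, u (-T + α * x) = c * s x := fun x hx => by
    have h3 := mul_le_mul_of_nonneg_left hx.2 hα.le
    have h4 := mul_nonneg hα.le hx.1
    rw [hc (-T + α * x) ⟨by linarith, by linarith⟩, asymProfile_left hα hβ hT hx.2]
  have hr : ∀ x ∈ Icc 0 M, u (T + -β * x) = c * s x := fun x hx => by
    have h3 := mul_le_mul_of_nonneg_left hx.2 hβ.le
    have h4 := mul_nonneg hβ.le hx.1
    rw [hc (T + -β * x) ⟨by linarith, by linarith⟩, asymProfile_right hα hβ hT hx.2]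
  rw [(hu.integral_asymDensity hp hM hα hβ hT).2,
    (hu.isHalfAdmissible_left hM hα hβ hT).integral_eq_zero_of_eq hg hp (div_pos hβ hα).le hl,
    (hu.isHalfAdmissible_right hM hα hβ hT).integral_eq_zero_of_eq hg hp (div_pos hα hβ).le hr,
    mul_zero, mul_zero, add_zero]

end Global

section Reflection

variable {p M α β T : ℝ} {g s u u' : ℝ → ℝ}

/-- The reflection `t ↦ -u (-t)` preserves the derivative up to reflection. -/
lemma MemW1p0.neg_comp_neg (hu : MemW1p0 p (-T) T u u') (hT : -T ≤ T) :
    MemW1p0 p (-T) T (fun t => -u (-t)) (fun t => u' (-t)) := by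
  obtain ⟨⟨hi, heq, hip⟩, h0, h1⟩ := hu
  have hrefl : ∀ f : ℝ → ℝ, IntervalIntegrable f volume (-T) T →
      IntervalIntegrable (fun t => f (-t)) volume (-T) T := fun f hf => by
    have h := (intervalIntegrable_comp_add_mul_iff (f := f) (a := T) (b := -T) (c := -1) (d := 0)
      (by norm_num)).2 (by simpa using hf)
    simpa using h.symm
  refine ⟨⟨hrefl _ hi, fun t ht => ?_, ?_⟩, by simp [h1], by simp [h0]⟩
  · have h2 := heq (-t) ⟨by linarith [ht.2], by linarith [ht.1]⟩
    have h3 := heq T ⟨hT, le_rfl⟩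
    have hsub : IntervalIntegrable u' volume (-T) (-t) := hi.mono_set (by
      rw [uIcc_of_le hT, uIcc_of_le (by linarith [ht.2])]
      exact Icc_subset_Icc_right (by linarith [ht.1]))
    have h4 := intervalIntegral.integral_interval_sub_left hi hsub
    simp only [intervalIntegral.integral_comp_neg, neg_neg]
    linarith
  · rw [← intervalIntegrable_iff_integrableOn_Ioo_of_le hT] at hip ⊢
    exact hrefl (fun t => |u' t| ^ p) hip

lemma MemW1p0.continuousOn (hu : MemW1p0 p (-T) T u u') (hT : -T ≤ T) :
    ContinuousOn u (Icc (-T) T) := by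
  have h := (hu.1.1.absolutelyContinuousOnInterval_intervalIntegral left_mem_uIcc).continuousOn
  rw [uIcc_of_le hT] at h
  refine h.congr fun t ht => ?_
  rw [hu.1.2.1 t ht, hu.2.1, zero_add]

lemma MemW1p0.integrable_mass (hu : MemW1p0 p (-T) T u u') (hT : -T ≤ T) (hp : 1 < p) :
    IntervalIntegrable (fun t => |u t| ^ p) volume (-T) T := by
  refine ContinuousOn.intervalIntegrable ?_
  rw [uIcc_of_le hT]
  exact (hu.continuousOn hT).abs.rpow_const fun x _ => Or.inr (by linarith)

lemma asymNorm_nonneg (hα : 0 ≤ α) (hβ : 0 ≤ β) (v : ℝ) : 0 ≤ α * ppart v + β * npart v :=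
  add_nonneg (mul_nonneg hα (le_max_right _ _)) (mul_nonneg hβ (le_max_right _ _))

lemma asymNorm_le (hα : 0 ≤ α) (hβ : 0 ≤ β) (v : ℝ) :
    α * ppart v + β * npart v ≤ (α + β) * |v| := by
  have h1 : ppart v ≤ |v| := max_le (le_abs_self _) (abs_nonneg _)
  have h2 : npart v ≤ |v| := max_le (neg_le_abs _) (abs_nonneg _)
  nlinarith [mul_le_mul_of_nonneg_left h1 hα, mul_le_mul_of_nonneg_left h2 hβ]

lemma MemW1p0.integrable_energy (hu : MemW1p0 p (-T) T u u') (hT : -T ≤ T) (hp : 1 < p)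
    (hα : 0 ≤ α) (hβ : 0 ≤ β) :
    IntervalIntegrable (fun t => (α * ppart (u' t) + β * npart (u' t)) ^ p) volume (-T) T := by
  have hi := hu.1.1
  have hip := hu.1.2.2
  rw [intervalIntegrable_iff_integrableOn_Ioo_of_le hT] at hi ⊢
  have hm := hi.aestronglyMeasurable.aemeasurable
  refine Integrable.mono' (hip.const_mul ((α + β) ^ p))
    ((((hm.max aemeasurable_const).const_mul α).add
      ((hm.neg.max aemeasurable_const).const_mul β)).pow_const p).aestronglyMeasurable
    (ae_of_all _ fun t => ?_)
  have h0 := asymNorm_nonneg hα hβ (u' t)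
  rw [Real.norm_eq_abs, abs_of_nonneg (Real.rpow_nonneg h0 _),
    ← Real.mul_rpow (add_nonneg hα hβ) (abs_nonneg _)]
  exact Real.rpow_le_rpow h0 (asymNorm_le hα hβ _) (by linarith)

lemma asymDensity_add_le (hα : 0 ≤ α) (hβ : 0 ≤ β) (hp : 1 < p) (t : ℝ) :
    asymDensity p α β u u' t + asymDensity p α β (fun t => -u (-t)) (fun t => u' (-t)) (-t) ≤
      (α * ppart (u' t) + β * npart (u' t)) ^ p - |u t| ^ p := by
  have h0 := Real.rpow_nonneg (asymNorm_nonneg hα hβ (u' t)) p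
  have hz : (0 : ℝ) ^ p = 0 := Real.zero_rpow (by linarith)
  simp only [asymDensity, neg_neg, Left.neg_pos_iff]
  rcases lt_trichotomy (u t) 0 with h | h | h
  · rw [if_neg h.not_gt, if_pos h, max_eq_right h.le, max_eq_left (by linarith), abs_of_neg h, hz]
    linarith
  · simpa [h, hz] using h0
  · rw [if_neg h.not_gt, if_pos h, max_eq_left h.le, max_eq_right (by linarith), abs_of_pos h, hz]
    linarith

lemma MemW1p0.integral_asymDensity_add_le (hu : MemW1p0 p (-T) T u u') (hp : 1 < p) (hM : 0 < M)
    (hα : 0 < α) (hβ : 0 < β) (hT : α * M + β * M = 2 * T) :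
    (∫ t in (-T)..T, asymDensity p α β u u' t) +
        ∫ t in (-T)..T, asymDensity p α β (fun t => -u (-t)) (fun t => u' (-t)) t ≤
      (∫ t in (-T)..T, (α * ppart (u' t) + β * npart (u' t)) ^ p) -
        ∫ t in (-T)..T, |u t| ^ p := by
  have hT' : -T ≤ T := by nlinarith [mul_pos hα hM, mul_pos hβ hM]
  have h1 := (hu.integral_asymDensity hp hM hα hβ hT).1
  have h2 := ((hu.neg_comp_neg hT').integral_asymDensity hp hM hα hβ hT).1
  have h3 : IntervalIntegrable (fun t =>
      asymDensity p α β (fun t => -u (-t)) (fun t => u' (-t)) (-t)) volume (-T) T := by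
    have h := (intervalIntegrable_comp_add_mul_iff
      (f := asymDensity p α β (fun t => -u (-t)) (fun t => u' (-t))) (a := T) (b := -T) (c := -1)
      (d := 0) (by norm_num)).2 (by simpa using h2)
    simpa using h.symm
  have h4 : ∫ t in (-T)..T, asymDensity p α β (fun t => -u (-t)) (fun t => u' (-t)) t =
      ∫ t in (-T)..T, asymDensity p α β (fun t => -u (-t)) (fun t => u' (-t)) (-t) := by
    rw [intervalIntegral.integral_comp_neg (fun t =>
      asymDensity p α β (fun t => -u (-t)) (fun t => u' (-t)) t), neg_neg]
  have hE := hu.integrable_energy hT' hp hα.le hβ.le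
  have hm := hu.integrable_mass hT' hp
  rw [h4, ← intervalIntegral.integral_add h1 h3, ← intervalIntegral.integral_sub hE hm]
  exact intervalIntegral.integral_mono_on hT' (h1.add h3) (hE.sub hm) fun t _ =>
    asymDensity_add_le hα.le hβ.le hp t

lemma pos_of_mul_add_mul_eq (hM : 0 < M) (hα : 0 < α) (hβ : 0 < β)
    (hT : α * M + β * M = 2 * T) : 0 < T := by
  linarith [mul_pos hα hM, mul_pos hβ hM]

variable (hg : IsSineProfile p M g s)
include hg

lemma IsSineProfile.asymProfile_pos (hα : 0 < α) (hβ : 0 < β) (hT : α * M + β * M = 2 * T) {t : ℝ}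
    (ht : t ∈ Ioo (-T) T) : 0 < asymProfile α β T s t := by
  rcases exists_eq_left_or_right hα hβ hT (Ioo_subset_Icc_self ht) with
    ⟨x, hx, rfl⟩ | ⟨x, hx, rfl⟩
  · rw [asymProfile_left hα hβ hT hx.2]
    exact hg.s_pos x ⟨by have := ht.1; by_contra h; nlinarith [not_lt.1 h], hx.2⟩
  · rw [asymProfile_right hα hβ hT hx.2]
    exact hg.s_pos x ⟨by have := ht.2; by_contra h; nlinarith [not_lt.1 h], hx.2⟩

lemma IsSineProfile.asymProfile_neg_end (hα : 0 < α) (hβ : 0 < β) (hT : α * M + β * M = 2 * T) :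
    asymProfile α β T s (-T) = 0 := by
  have := asymProfile_left (s := s) hα hβ hT hg.quarter_pos.le
  rwa [mul_zero, add_zero, hg.s_zero] at this

lemma IsSineProfile.asymProfile_end (hα : 0 < α) (hβ : 0 < β) (hT : α * M + β * M = 2 * T) :
    asymProfile α β T s T = 0 := by
  have := asymProfile_right (s := s) hα hβ hT hg.quarter_pos.le
  rwa [mul_zero, add_zero, hg.s_zero] at this

/-- Sharp asymmetric Poincaré inequality, in normalized form. -/
lemma MemW1p0.mass_le_energy (hu : MemW1p0 p (-T) T u u') (hp : 1 < p)
    (hα : 0 < α) (hβ : 0 < β) (hT : α * M + β * M = 2 * T) :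
    ∫ t in (-T)..T, |u t| ^ p ≤ ∫ t in (-T)..T, (α * ppart (u' t) + β * npart (u' t)) ^ p := by
  have hM := hg.quarter_pos
  have hT0 := pos_of_mul_add_mul_eq hM hα hβ hT
  have h1 := hu.integral_asymDensity_add_le hp hM hα hβ hT
  have h2 := hu.integral_asymDensity_nonneg hg hp hα hβ hT
  have h3 := (hu.neg_comp_neg (by linarith)).integral_asymDensity_nonneg hg hp hα hβ hT
  linarith

lemma MemW1p0.energy_eq_mass_of_eq (hu : MemW1p0 p (-T) T u u') (hp : 1 < p)
    (hα : 0 < α) (hβ : 0 < β) (hT : α * M + β * M = 2 * T) {c : ℝ} (hc : 0 < c)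
    (h : ∀ t ∈ Ioo (-T) T, u t = c * asymProfile α β T s t) :
    ∫ t in (-T)..T, (α * ppart (u' t) + β * npart (u' t)) ^ p = ∫ t in (-T)..T, |u t| ^ p := by
  have hM := hg.quarter_pos
  have hT0 := pos_of_mul_add_mul_eq hM hα hβ hT
  have hT' : -T ≤ T := by linarith
  have hIcc : ∀ t ∈ Icc (-T) T, u t = c * asymProfile α β T s t := fun t ht => by
    rcases ht.1.eq_or_lt with h1 | h1
    · rw [← h1, hu.2.1, hg.asymProfile_neg_end hα hβ hT, mul_zero]
    rcases ht.2.eq_or_lt with h2 | h2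
    · rw [h2, hu.2.2, hg.asymProfile_end hα hβ hT, mul_zero]
    exact h t ⟨h1, h2⟩
  have h0 := hu.integral_asymDensity_eq_zero hg hp hα hβ hT hIcc
  rw [← sub_eq_zero, ← intervalIntegral.integral_sub (hu.integrable_energy hT' hp hα.le hβ.le)
    (hu.integrable_mass hT' hp), ← h0]
  refine intervalIntegral.integral_congr_ae ?_
  have hne : ∀ᵐ t : ℝ, t ≠ T := by simp [ae_iff, measure_singleton]
  filter_upwards [hne] with t htT ht
  rw [uIoc_of_le hT'] at ht
  have htI : t ∈ Ioo (-T) T := ⟨ht.1, lt_of_le_of_ne ht.2 htT⟩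
  have hpos : 0 < u t := by
    rw [h t htI]; exact mul_pos hc (hg.asymProfile_pos hα hβ hT htI)
  rw [asymDensity, if_pos hpos, max_eq_left hpos.le, abs_of_pos hpos]

/-- Extremals of the normalized sharp asymmetric Poincaré inequality. -/
lemma MemW1p0.energy_eq_mass_iff (hu : MemW1p0 p (-T) T u u') (hp : 1 < p)
    (hα : 0 < α) (hβ : 0 < β) (hT : α * M + β * M = 2 * T)
    (hne : ¬ ∀ t ∈ Ioo (-T) T, u t = 0) :
    ∫ t in (-T)..T, (α * ppart (u' t) + β * npart (u' t)) ^ p = ∫ t in (-T)..T, |u t| ^ p ↔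
      ∃ c > 0, (∀ t ∈ Ioo (-T) T, u t = c * asymProfile α β T s t) ∨
        ∀ t ∈ Ioo (-T) T, u t = -c * asymProfile α β T s (-t) := by
  have hM := hg.quarter_pos
  have hT0 := pos_of_mul_add_mul_eq hM hα hβ hT
  have hv := hu.neg_comp_neg (by linarith)
  have hneg : ∀ t ∈ Ioo (-T) T, -t ∈ Ioo (-T) T := fun t ht =>
    ⟨by linarith [ht.2], by linarith [ht.1]⟩
  constructor
  · intro h
    have h1 := hu.integral_asymDensity_add_le hp hM hα hβ hT
    have h2 := hu.integral_asymDensity_nonneg hg hp hα hβ hT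
    have h3 := hv.integral_asymDensity_nonneg hg hp hα hβ hT
    obtain ⟨c, hc, hcu⟩ := hu.eq_of_integral_asymDensity_eq_zero hg hp hα hβ hT (by linarith)
    obtain ⟨d, hd, hdu⟩ := hv.eq_of_integral_asymDensity_eq_zero hg hp hα hβ hT (by linarith)
    rcases hc.eq_or_lt with rfl | hc
    · rcases hd.eq_or_lt with rfl | hd
      · refine absurd (fun t ht => ?_) hne
        have h4 := hcu t (Ioo_subset_Icc_self ht)
        have h5 := hdu (-t) (Ioo_subset_Icc_self (hneg t ht))
        simp only [zero_mul, neg_neg] at h4 h5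
        have h6 := le_max_left (u t) 0
        have h7 := le_max_left (-u t) 0
        linarith
      · refine ⟨d, hd, Or.inr fun t ht => ?_⟩
        have h5 := hdu (-t) (Ioo_subset_Icc_self (hneg t ht))
        have h6 := mul_pos hd (hg.asymProfile_pos hα hβ hT (hneg t ht))
        rw [← h5, neg_neg] at h6
        rw [neg_neg, max_eq_left ((lt_max_iff.1 h6).resolve_right (lt_irrefl _)).le] at h5
        linarith
    · refine ⟨c, hc, Or.inl fun t ht => ?_⟩
      have h5 := hcu t (Ioo_subset_Icc_self ht)
      have h6 := mul_pos hc (hg.asymProfile_pos hα hβ hT ht)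
      rw [← h5] at h6
      rwa [max_eq_left ((lt_max_iff.1 h6).resolve_right (lt_irrefl _)).le] at h5
  · rintro ⟨c, hc, h | h⟩
    · exact hu.energy_eq_mass_of_eq hg hp hα hβ hT hc h
    · have h1 := hv.energy_eq_mass_of_eq hg hp hα hβ hT hc fun t ht => by
        rw [h (-t) (hneg t ht), neg_neg, neg_mul, neg_neg]
      simp only [abs_neg] at h1
      rw [intervalIntegral.integral_comp_neg (fun t => (α * ppart (u' t) + β * npart (u' t)) ^ p),
        intervalIntegral.integral_comp_neg (fun t => |u t| ^ p), neg_neg] at h1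
      exact h1

end Reflection

section Trial

variable {p M α β T : ℝ} {g s u u' : ℝ → ℝ}

lemma integral_Ioo_eq_intervalIntegral {a b : ℝ} (hab : a ≤ b) (f : ℝ → ℝ) :
    ∫ t in Ioo a b, f t = ∫ t in a..b, f t := by
  rw [intervalIntegral.integral_of_le hab, integral_Ioc_eq_integral_Ioo]

lemma LipschitzOnWith.memW1p0 {f : ℝ → ℝ} {K : NNReal} (hf : LipschitzOnWith K f (Icc (-T) T))
    (hp : 0 ≤ p) (hT : -T ≤ T) (h0 : f (-T) = 0) (h1 : f T = 0) :
    MemW1p0 p (-T) T f (deriv f) := by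
  have hAC : AbsolutelyContinuousOnInterval f (-T) T :=
    LipschitzOnWith.absolutelyContinuousOnInterval (K := K) (by rwa [uIcc_of_le hT])
  refine ⟨⟨hAC.intervalIntegrable_deriv, fun t ht => ?_, ?_⟩, h0, h1⟩
  · rw [(hAC.mono (by rw [uIcc_of_le hT, uIcc_of_le ht.1]; exact Icc_subset_Icc_right ht.2)
      ).integral_deriv_eq_sub, add_sub_cancel]
  · refine Measure.integrableOn_of_bounded (M := (K : ℝ) ^ p) measure_Ioo_lt_top.ne
      ((measurable_deriv f).abs.pow_const p).aestronglyMeasurable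
      ((ae_restrict_iff' measurableSet_Ioo).2 (ae_of_all _ fun t ht => ?_))
    rw [Real.norm_eq_abs, abs_of_nonneg (by positivity)]
    exact Real.rpow_le_rpow (abs_nonneg _)
      (norm_deriv_le_of_lipschitzOn (Icc_mem_nhds ht.1 ht.2) hf) hp

lemma MemW1p0.const_mul (hu : MemW1p0 p (-T) T u u') (c : ℝ) :
    MemW1p0 p (-T) T (fun t => c * u t) (fun t => c * u' t) := by
  obtain ⟨⟨hi, heq, hip⟩, h0, h1⟩ := hu
  refine ⟨⟨hi.const_mul c, fun t ht => ?_, ?_⟩, by simp [h0], by simp [h1]⟩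
  · rw [intervalIntegral.integral_const_mul]
    change c * u t = c * u (-T) + _
    rw [heq t ht]; ring
  · simp only [abs_mul, Real.mul_rpow (abs_nonneg _) (abs_nonneg _)]
    exact hip.const_mul _

lemma lipschitzWith_min_affine (hα : 0 < α) (hβ : 0 < β) :
    ∃ K : NNReal, LipschitzWith K fun t => min ((t + T) / α) ((T - t) / β) := by
  refine ⟨_, LipschitzWith.min (Kf := ⟨1 / α, by positivity⟩) (Kg := ⟨1 / β, by positivity⟩)
    (LipschitzWith.of_dist_le_mul fun x y => ?_) (LipschitzWith.of_dist_le_mul fun x y => ?_)⟩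
  · rw [Real.dist_eq, Real.dist_eq, ← sub_div, abs_div, abs_of_pos hα]
    change _ ≤ 1 / α * _
    rw [one_div_mul_eq_div]
    ring_nf; rfl
  · rw [Real.dist_eq, Real.dist_eq, ← sub_div, abs_div, abs_of_pos hβ, abs_sub_comm x y]
    change _ ≤ 1 / β * _
    rw [one_div_mul_eq_div]
    ring_nf; rfl

lemma energy_mul {m a b : ℝ} (hm : 0 ≤ m) (hα : 0 ≤ α) (hβ : 0 ≤ β) (ha : a = m * α)
    (hb : b = m * β) (u' : ℝ → ℝ) (S : Set ℝ) :
    ∫ t in S, (a * ppart (u' t) + b * npart (u' t)) ^ p =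
      m ^ p * ∫ t in S, (α * ppart (u' t) + β * npart (u' t)) ^ p := by
  rw [← integral_const_mul]
  congr 1
  ext t
  rw [← Real.mul_rpow hm (asymNorm_nonneg hα hβ _), ha, hb]
  ring_nf

variable (hg : IsSineProfile p M g s)
include hg

lemma IsSineProfile.lipschitzOnWith (hp : 1 < p) :
    ∃ K : NNReal, LipschitzOnWith K s (Icc 0 M) := by
  have hM := hg.quarter_pos
  have hp1 : 0 < p - 1 := by linarith
  refine ⟨((1 / (p - 1)) ^ (1 / p)).toNNReal, ?_⟩
  rw [← closure_Ioo hM.ne]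
  refine LipschitzOnWith.closure (by rw [closure_Ioo hM.ne]; exact hg.s_cont) ?_
  refine (convex_Ioo 0 M).lipschitzOnWith_of_nnnorm_hasDerivWithin_le
    (fun t ht => (hg.s_deriv t (Ioo_subset_Ioc_self ht)).hasDerivWithinAt) fun t ht => ?_
  have h0 : 0 ≤ s t * g t ^ (1 / (p - 1)) :=
    mul_nonneg (hg.s_pos t (Ioo_subset_Ioc_self ht)).le (Real.rpow_nonneg (hg.g_pos t ht).le _)
  rw [← NNReal.coe_le_coe, coe_nnnorm, Real.norm_eq_abs, abs_of_nonneg h0,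
    Real.coe_toNNReal _ (by positivity)]
  have h1 := Real.rpow_le_rpow (Real.rpow_nonneg h0 p) (hg.s_deriv_bdd t (Ioo_subset_Ioc_self ht))
    (show 0 ≤ 1 / p by positivity)
  rwa [← Real.rpow_mul h0, mul_one_div_cancel (by linarith), Real.rpow_one] at h1

lemma IsSineProfile.memW1p0_asymProfile (hp : 1 < p) (hα : 0 < α) (hβ : 0 < β)
    (hT : α * M + β * M = 2 * T) :
    MemW1p0 p (-T) T (asymProfile α β T s) (deriv (asymProfile α β T s)) := by
  have hM := hg.quarter_pos
  have hT0 := pos_of_mul_add_mul_eq hM hα hβ hT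
  obtain ⟨K, hK⟩ := hg.lipschitzOnWith hp
  obtain ⟨L, hL⟩ := lipschitzWith_min_affine (T := T) hα hβ
  refine LipschitzOnWith.memW1p0 (hK.comp hL.lipschitzOnWith fun t ht => ?_) (by linarith)
    (by linarith) (hg.asymProfile_neg_end hα hβ hT) (hg.asymProfile_end hα hβ hT)
  refine ⟨le_min (div_nonneg (by linarith [ht.1]) hα.le) (div_nonneg (by linarith [ht.2]) hβ.le),
    ?_⟩
  rcases le_total t (-T + α * M) with h | h
  · exact (min_le_left _ _).trans ((div_le_iff₀ hα).2 (by linarith))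
  · exact (min_le_right _ _).trans ((div_le_iff₀ hβ).2 (by linarith))

lemma IsSineProfile.lamAB_eq (hp : 1 < p) (hα : 0 < α) (hβ : 0 < β)
    (hT : α * M + β * M = 2 * T) {m a b : ℝ} (hm : 0 ≤ m) (ha : a = m * α) (hb : b = m * β) :
    lamAB p a b (-T) T = m ^ p := by
  have hM := hg.quarter_pos
  have hT0 := pos_of_mul_add_mul_eq hM hα hβ hT
  have hT' : -T ≤ T := by linarith
  refine IsLeast.csInf_eq ⟨?_, ?_⟩
  · have hΦ := hg.memW1p0_asymProfile hp hα hβ hT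
    have hN : 0 < ∫ t in (-T)..T, |asymProfile α β T s t| ^ p :=
      intervalIntegral.intervalIntegral_pos_of_pos_on (hΦ.integrable_mass hT' hp)
        (fun t ht => Real.rpow_pos_of_pos (abs_pos.2 (hg.asymProfile_pos hα hβ hT ht).ne') _)
        (by linarith)
    set N := ∫ t in (-T)..T, |asymProfile α β T s t| ^ p
    have hc : 0 < N ^ (-(1 / p)) := Real.rpow_pos_of_pos hN _
    have hu := hΦ.const_mul (N ^ (-(1 / p)))
    have hE := hu.energy_eq_mass_of_eq hg hp hα hβ hT hc fun t _ => rfl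
    have hmass : ∫ t in (-T)..T, |N ^ (-(1 / p)) * asymProfile α β T s t| ^ p = 1 := by
      simp only [abs_mul, Real.mul_rpow (abs_nonneg _) (abs_nonneg _)]
      rw [intervalIntegral.integral_const_mul, abs_of_pos hc, ← Real.rpow_mul hN.le]
      change _ * N = 1
      rw [show -(1 / p) * p = -1 by field_simp, Real.rpow_neg_one, inv_mul_cancel₀ hN.ne']
    refine ⟨_, _, hu, by rw [integral_Ioo_eq_intervalIntegral hT', hmass], ?_⟩
    rw [energy_mul hm hα.le hβ.le ha hb, integral_Ioo_eq_intervalIntegral hT', hE, hmass, mul_one]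
  · rintro _ ⟨u, u', hu, h1, rfl⟩
    rw [energy_mul hm hα.le hβ.le ha hb]
    have h := hu.mass_le_energy hg hp hα hβ hT
    rw [← integral_Ioo_eq_intervalIntegral hT', ← integral_Ioo_eq_intervalIntegral hT', h1] at h
    exact le_mul_of_one_le_right (Real.rpow_nonneg hm _) h

end Trial

lemma abs_eq_ppart_add_npart (v : ℝ) : |v| = 1 * ppart v + 1 * npart v := by
  unfold ppart npart
  rcases le_total 0 v with h | h
  · rw [abs_of_nonneg h, max_eq_left h, max_eq_right (by linarith)]; ring
  · rw [abs_of_nonpos h, max_eq_right h, max_eq_left (by linarith)]; ring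

/-- Extremals for general weights. -/
lemma MemW1p0.energy_eq_lamAB_mul_mass_iff {p M α β T m a b : ℝ} {g s u u' : ℝ → ℝ}
    (hg : IsSineProfile p M g s) (hu : MemW1p0 p (-T) T u u') (hp : 1 < p) (hα : 0 < α)
    (hβ : 0 < β) (hT : α * M + β * M = 2 * T) (hm : 0 < m) (ha : a = m * α) (hb : b = m * β)
    (hne : ¬ ∀ t ∈ Ioo (-T) T, u t = 0) :
    (∫ t in Ioo (-T) T, (a * ppart (u' t) + b * npart (u' t)) ^ p) =
        lamAB p a b (-T) T * ∫ t in Ioo (-T) T, |u t| ^ p ↔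
      ∃ c > 0, (∀ t ∈ Ioo (-T) T, u t = c * asymProfile α β T s t) ∨
        ∀ t ∈ Ioo (-T) T, u t = -c * asymProfile α β T s (-t) := by
  have hT' : -T ≤ T := by linarith [pos_of_mul_add_mul_eq hg.quarter_pos hα hβ hT]
  rw [hg.lamAB_eq hp hα hβ hT hm.le ha hb, energy_mul hm.le hα.le hβ.le ha hb,
    mul_right_inj' (Real.rpow_pos_of_pos hm p).ne', integral_Ioo_eq_intervalIntegral hT',
    integral_Ioo_eq_intervalIntegral hT']
  exact hu.energy_eq_mass_iff hg hp hα hβ hT hne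

/-- The principal eigenfunction is a multiple of the symmetric profile. -/
lemma IsPrincipalEigenfunction.exists_eq {p T M : ℝ} {g s φ φ' : ℝ → ℝ}
    (hφ : IsPrincipalEigenfunction p T φ φ') (hg : IsSineProfile p M g s) (hp : 1 < p)
    (hT : 0 < T) :
    ∃ c > 0, ∀ t ∈ Ioo (-T) T, φ t = c * asymProfile (T / M) (T / M) T s t := by
  obtain ⟨hmem, hpos, hmass, hE⟩ := hφ
  have hM := hg.quarter_pos
  have hσ : 0 < T / M := div_pos hT hM
  have hT2 : T / M * M + T / M * M = 2 * T := by field_simp; ring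
  have h0 : (0 : ℝ) ∈ Ioo (-T) T := ⟨by linarith, hT⟩
  have hm1 : (1 : ℝ) = M / T * (T / M) := by field_simp
  have hlam : lam1 p (-T) T = lamAB p 1 1 (-T) T := by
    unfold lam1 lamAB
    simp only [abs_eq_ppart_add_npart]
  have h := (hmem.energy_eq_lamAB_mul_mass_iff hg hp hσ hσ hT2 (div_pos hM hT) hm1 hm1
    fun h => (hpos 0 h0).ne' (h 0 h0)).1 (by
      rw [hmass, mul_one, ← hlam, ← hE]; simp only [abs_eq_ppart_add_npart])
  obtain ⟨c, hc, h | h⟩ := h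
  · exact ⟨c, hc, h⟩
  · have h1 := hpos 0 h0
    have h2 := mul_pos hc (hg.asymProfile_pos hσ hσ hT2 h0)
    rw [h 0 h0, neg_zero] at h1
    linarith

section Rescaling

variable {M α β T t₀ t : ℝ} {s : ℝ → ℝ}

lemma asymProfile_comp_neg (σ T : ℝ) (s : ℝ → ℝ) (t : ℝ) :
    asymProfile σ σ T s (-t) = asymProfile σ σ T s t := by
  unfold asymProfile
  rw [min_comm]
  ring_nf

lemma asymProfile_rescale_left (hM : 0 < M) (hα : 0 < α) (hβ : 0 < β) (h1 : T + t₀ = α * M)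
    (h2 : T - t₀ = β * M) (ht : -T < t) (ht₀ : t ≤ t₀) :
    T * (t - t₀) / (T + t₀) ∈ Ioo (-T) T ∧
      asymProfile (T / M) (T / M) T s (T * (t - t₀) / (T + t₀)) = asymProfile α β T s t := by
  have hT : α * M + β * M = 2 * T := by linarith
  have hT0 := pos_of_mul_add_mul_eq hM hα hβ hT
  have hx0 : 0 < (t + T) / α := div_pos (by linarith) hα
  have hxM : (t + T) / α ≤ M := (div_le_iff₀ hα).2 (by linarith)
  have hσ : 0 < T / M := div_pos hT0 hM
  have harg : T * (t - t₀) / (T + t₀) = -T + T / M * ((t + T) / α) := by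
    rw [show t - t₀ = t + T - α * M by linarith, h1]; field_simp; ring
  have htx : t = -T + α * ((t + T) / α) := by field_simp; ring
  have hle : T / M * ((t + T) / α) ≤ T := by
    calc _ ≤ T / M * M := by gcongr
      _ = T := by field_simp
  rw [harg]
  refine ⟨⟨by linarith [mul_pos hσ hx0], by linarith⟩, ?_⟩
  rw [asymProfile_left hσ hσ (by field_simp; ring) hxM]
  conv_rhs => rw [htx]
  rw [asymProfile_left hα hβ hT hxM]

lemma asymProfile_rescale_right (hM : 0 < M) (hα : 0 < α) (hβ : 0 < β) (h1 : T + t₀ = α * M)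
    (h2 : T - t₀ = β * M) (ht : t < T) (ht₀ : t₀ ≤ t) :
    T * (t - t₀) / (T - t₀) ∈ Ioo (-T) T ∧
      asymProfile (T / M) (T / M) T s (T * (t - t₀) / (T - t₀)) = asymProfile α β T s t := by
  have h := asymProfile_rescale_left (s := s) (t := -t) (t₀ := -t₀) hM hβ hα (by linarith)
    (by linarith) (neg_lt_neg ht) (neg_le_neg ht₀)
  have harg : T * (-t - -t₀) / (T + -t₀) = -(T * (t - t₀) / (T - t₀)) := by
    rw [← neg_div]; ring_nf
  rw [harg, asymProfile_comp_neg] at h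
  refine ⟨⟨by linarith [h.1.2], by linarith [h.1.1]⟩, h.2.trans ?_⟩
  unfold asymProfile
  rw [min_comm]
  ring_nf

end Rescaling

theorem lamAB_extremizers (p T a b : ℝ) (hp : 1 < p) (hT : 0 < T) (ha : 0 < a) (hb : 0 < b)
    (φp φp' : ℝ → ℝ) (hφ : IsPrincipalEigenfunction p T φp φp')
    (u u' : ℝ → ℝ) (hu : MemW1p0 p (-T) T u u')
    (hne : ¬ ∀ t ∈ Set.Ioo (-T) T, u t = 0) :
    (∫ t in Set.Ioo (-T) T, (a * ppart (u' t) + b * npart (u' t)) ^ p)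
        = lamAB p a b (-T) T * ∫ t in Set.Ioo (-T) T, |u t| ^ p
      ↔ ∃ c > 0,
        (∀ t ∈ Set.Ioo (-T) T,
          u t = if t < (a - b) / (a + b) * T
            then c * φp (T * (t - (a - b) / (a + b) * T) / (T + (a - b) / (a + b) * T))
            else c * φp (T * (t - (a - b) / (a + b) * T) / (T - (a - b) / (a + b) * T))) ∨
        (∀ t ∈ Set.Ioo (-T) T,
          u t = if t < -((a - b) / (a + b) * T)
            then -c * φp (T * (t + (a - b) / (a + b) * T) / (T - (a - b) / (a + b) * T))
            else -c * φp (T * (t + (a - b) / (a + b) * T) / (T + (a - b) / (a + b) * T))) := by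
  obtain ⟨M, g, s, hg⟩ := exists_isSineProfile hp
  have hM := hg.quarter_pos
  have hab : 0 < a + b := add_pos ha hb
  set m := (a + b) * M / (2 * T) with hmdef
  have hm : 0 < m := by positivity
  set α := a / m with hαdef
  set β := b / m with hβdef
  have hα : 0 < α := div_pos ha hm
  have hβ : 0 < β := div_pos hb hm
  have ham : a = m * α := by rw [hαdef]; field_simp
  have hbm : b = m * β := by rw [hβdef]; field_simp
  set t₀ := (a - b) / (a + b) * T with ht₀
  have h1 : T + t₀ = α * M := by rw [ht₀, hαdef, hmdef]; field_simp; ring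
  have h2 : T - t₀ = β * M := by rw [ht₀, hβdef, hmdef]; field_simp; ring
  rw [hu.energy_eq_lamAB_mul_mass_iff hg hp hα hβ (by linarith) hm ham hbm hne]
  obtain ⟨c₁, hc₁, hφc⟩ := hφ.exists_eq hg hp hT
  have hleft : ∀ t ∈ Ioo (-T) T, t ≤ t₀ →
      φp (T * (t - t₀) / (T + t₀)) = c₁ * asymProfile α β T s t := fun t ht h => by
    obtain ⟨h3, h4⟩ := asymProfile_rescale_left (s := s) hM hα hβ h1 h2 ht.1 h
    rw [hφc _ h3, h4]
  have hright : ∀ t ∈ Ioo (-T) T, t₀ ≤ t →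
      φp (T * (t - t₀) / (T - t₀)) = c₁ * asymProfile α β T s t := fun t ht h => by
    obtain ⟨h3, h4⟩ := asymProfile_rescale_right (s := s) hM hα hβ h1 h2 ht.2 h
    rw [hφc _ h3, h4]
  have hneg : ∀ t ∈ Ioo (-T) T, -t ∈ Ioo (-T) T := fun t ht =>
    ⟨by linarith [ht.2], by linarith [ht.1]⟩
  have hleft' : ∀ t ∈ Ioo (-T) T, -t₀ ≤ t →
      φp (T * (t + t₀) / (T + t₀)) = c₁ * asymProfile α β T s (-t) := fun t ht h => by
    obtain ⟨h3, h4⟩ := asymProfile_rescale_left (s := s) (t := -t) hM hα hβ h1 h2 (hneg t ht).1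
      (by linarith)
    rw [show T * (-t - t₀) / (T + t₀) = -(T * (t + t₀) / (T + t₀)) by rw [← neg_div]; ring_nf]
      at h3 h4
    have h5 := hneg _ h3
    rw [neg_neg] at h5
    rw [hφc _ h5, ← h4, asymProfile_comp_neg]
  have hright' : ∀ t ∈ Ioo (-T) T, t ≤ -t₀ →
      φp (T * (t + t₀) / (T - t₀)) = c₁ * asymProfile α β T s (-t) := fun t ht h => by
    obtain ⟨h3, h4⟩ := asymProfile_rescale_right (s := s) (t := -t) hM hα hβ h1 h2 (hneg t ht).2
      (by linarith)
    rw [show T * (-t - t₀) / (T - t₀) = -(T * (t + t₀) / (T - t₀)) by rw [← neg_div]; ring_nf]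
      at h3 h4
    have h5 := hneg _ h3
    rw [neg_neg] at h5
    rw [hφc _ h5, ← h4, asymProfile_comp_neg]
  have hpos : ∀ c, ∀ t ∈ Ioo (-T) T, (if t < t₀ then c * φp (T * (t - t₀) / (T + t₀))
      else c * φp (T * (t - t₀) / (T - t₀))) = c * c₁ * asymProfile α β T s t := fun c t ht => by
    split_ifs with h
    · rw [hleft t ht h.le, mul_assoc]
    · rw [hright t ht (not_lt.1 h), mul_assoc]
  have hneg' : ∀ c, ∀ t ∈ Ioo (-T) T, (if t < -t₀ then -c * φp (T * (t + t₀) / (T - t₀))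
      else -c * φp (T * (t + t₀) / (T + t₀))) = -(c * c₁) * asymProfile α β T s (-t) :=
    fun c t ht => by
    split_ifs with h
    · rw [hright' t ht h.le]; ring
    · rw [hleft' t ht (not_lt.1 h)]; ring
  constructor
  · rintro ⟨c, hc, h⟩
    refine ⟨c / c₁, div_pos hc hc₁, h.imp (fun h t ht => ?_) fun h t ht => ?_⟩
    · rw [hpos _ t ht, div_mul_cancel₀ _ hc₁.ne', h t ht]
    · rw [hneg' _ t ht, div_mul_cancel₀ _ hc₁.ne', h t ht]
  · rintro ⟨c, hc, h⟩
    refine ⟨c * c₁, mul_pos hc hc₁, h.imp (fun h t ht => ?_) fun h t ht => ?_⟩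
    · rw [h t ht, hpos _ t ht]
    · rw [h t ht, hneg' _ t ht]

end
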